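/- arXiv:1504.00917 — 4 statements merged into one kernel-verified Lean document; each statement's English description precedes it below -/
import Mathlib

section
/- For every ν ∈ ℝ \ ℤ and every z > 0, K_ν(z) = (π / (2 sin(πν))) · [ Σ_{j=0}^∞ (z/2)^{2j−ν} / (j! Γ(j+1−ν)) − Σ_{j=0}^∞ (z/2)^{2j+ν} / (j! Γ(j+1+ν)) ], where both series converge absolutely. -/
open MeasureTheory Real

/-- The modified Bessel function of the third kind (McDonald's function):
`K_ν(z) = (1/2) ∫₀^∞ s^(ν-1) exp(-(1/2)(s + 1/s) z) ds`. -/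
noncomputable def besselK (ν z : ℝ) : ℝ :=
  (1 / 2) * ∫ s in Set.Ioi (0 : ℝ), s ^ (ν - 1) * Real.exp (-(1 / 2) * (s + 1 / s) * z)

/-- The tail integral `∫₁^∞ s^(b-1) exp(-a s) ds`, a rescaled upper incomplete Gamma function. -/
noncomputable def gammaTail (b a : ℝ) : ℝ :=
  ∫ s in Set.Ioi (1 : ℝ), s ^ (b - 1) * Real.exp (-a * s)

lemma integrableOn_rpow_mul_exp_neg_mul_Ioi_one (c : ℝ) {a : ℝ} (ha : 0 < a) :
    IntegrableOn (fun s : ℝ => s ^ c * Real.exp (-a * s)) (Set.Ioi 1) := by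
  refine integrable_of_isBigO_exp_neg (b := a / 2) (half_pos ha) ?_ ?_
  · intro s hs
    have hs0 : s ≠ 0 := (zero_lt_one.trans_le hs).ne'
    exact ((Real.continuousAt_rpow_const _ _ (Or.inl hs0)).mul
      (by fun_prop)).continuousWithinAt
  · have h := (isLittleO_rpow_exp_pos_mul_atTop c (half_pos ha)).isBigO.mul
      (Asymptotics.isBigO_refl (fun s : ℝ => Real.exp (-a * s)) Filter.atTop)
    refine h.congr_right fun s => ?_
    rw [← Real.exp_add]
    ring_nf

lemma gammaTail_add_one (b : ℝ) {a : ℝ} (ha : 0 < a) :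
    a * gammaTail (b + 1) a = b * gammaTail b a + Real.exp (-a) := by
  have hint (c : ℝ) := integrableOn_rpow_mul_exp_neg_mul_Ioi_one c ha
  have hparts := integral_Ioi_of_hasDerivAt_of_tendsto (a := (1 : ℝ)) (m := (0 : ℝ))
    (f := fun s : ℝ => s ^ b * Real.exp (-a * s))
    (f' := fun s : ℝ => b * (s ^ (b - 1) * Real.exp (-a * s)) - a * (s ^ b * Real.exp (-a * s)))
    ((Real.continuousAt_rpow_const _ _ (Or.inl one_ne_zero)).mul
      (by fun_prop)).continuousWithinAt
    (fun s hs => by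
      have hs0 : s ≠ 0 := (zero_lt_one.trans hs).ne'
      have h1 := Real.hasDerivAt_rpow_const (p := b) (Or.inl hs0)
      have h2 : HasDerivAt (fun s : ℝ => Real.exp (-a * s)) (Real.exp (-a * s) * (-a * 1)) s :=
        ((hasDerivAt_id s).const_mul (-a)).exp
      refine (h1.mul h2).congr_deriv ?_
      ring)
    (((hint (b - 1)).const_mul b).sub ((hint b).const_mul a))
    (tendsto_rpow_mul_exp_neg_mul_atTop_nhds_zero b a ha)
  rw [integral_sub ((hint (b - 1)).const_mul b) ((hint b).const_mul a), integral_const_mul,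
    integral_const_mul] at hparts
  simp only [gammaTail, add_sub_cancel_right]
  simp only [Real.one_rpow, mul_one, one_mul] at hparts
  linarith

lemma exists_abs_inv_add_int_le {b : ℝ} (hb : ∀ n : ℤ, b ≠ n) :
    ∃ C : ℝ, ∀ k : ℤ, |(b + k)⁻¹| ≤ C := by
  refine ⟨|b - round b|⁻¹, fun k => ?_⟩
  rw [abs_inv]
  refine inv_anti₀ (abs_pos.2 (sub_ne_zero.2 (hb _))) ?_
  simpa using round_le b (-k)

lemma summable_pow_div_factorial_mul_add {b : ℝ} (hb : ∀ n : ℤ, b ≠ n) (x : ℝ) :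
    Summable fun m : ℕ => x ^ m / m.factorial * (b + m)⁻¹ := by
  obtain ⟨C, hC⟩ := exists_abs_inv_add_int_le hb
  refine Summable.of_norm_bounded ((Real.summable_pow_div_factorial |x|).mul_right C) fun m => ?_
  rw [Real.norm_eq_abs, abs_mul, abs_div, abs_pow, Nat.abs_cast]
  gcongr
  exact_mod_cast hC m

lemma tsum_pow_div_factorial_mul_add_one {b : ℝ} (hb : ∀ n : ℤ, b ≠ n) (x : ℝ) :
    x * ∑' m : ℕ, x ^ m / m.factorial * (b + 1 + m)⁻¹ =
      Real.exp x - b * ∑' m : ℕ, x ^ m / m.factorial * (b + m)⁻¹ := by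
  have hexp : HasSum (fun m : ℕ => x ^ m / m.factorial) (Real.exp x) := by
    rw [Real.exp_eq_exp_ℝ]
    exact NormedSpace.expSeries_div_hasSum_exp x
  have h := hexp.sub ((summable_pow_div_factorial_mul_add hb x).hasSum.mul_left b)
  have h0 : b ≠ 0 := by simpa using hb 0
  rw [← hasSum_nat_add_iff' 1] at h
  simp only [Finset.range_one, Finset.sum_singleton, pow_zero, Nat.factorial_zero, Nat.cast_one,
    Nat.cast_zero, add_zero, div_one, one_mul, mul_inv_cancel₀ h0, sub_self, sub_zero] at h
  rw [← h.tsum_eq, ← tsum_mul_left]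
  refine tsum_congr fun m => ?_
  have hm : b + (m + 1) ≠ 0 := fun h => hb (-(m + 1)) (by push_cast; linarith)
  have hm' : b + 1 + m ≠ 0 := by convert hm using 1; ring
  have hf : (m.factorial : ℝ) ≠ 0 := by positivity
  have hm1 : (m + 1 : ℝ) ≠ 0 := by positivity
  rw [Nat.factorial_succ]
  push_cast
  field_simp
  ring

lemma integrableOn_rpow_Ioc_zero_one {c : ℝ} (hc : -1 < c) :
    IntegrableOn (fun s : ℝ => s ^ c) (Set.Ioc 0 1) :=
  (intervalIntegrable_iff_integrableOn_Ioc_of_le zero_le_one).1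
    (intervalIntegral.intervalIntegrable_rpow' hc)

lemma integral_rpow_Ioc_zero_one {c : ℝ} (hc : -1 < c) :
    ∫ s in Set.Ioc (0 : ℝ) 1, s ^ c = (c + 1)⁻¹ := by
  rw [← intervalIntegral.integral_of_le zero_le_one, integral_rpow (Or.inl hc), Real.one_rpow,
    Real.zero_rpow (by linarith), sub_zero, one_div]

lemma tsum_pow_mul_div_factorial (x y : ℝ) :
    ∑' m : ℕ, x ^ m / m.factorial * y ^ m = Real.exp (x * y) := by
  rw [Real.exp_eq_exp_ℝ, NormedSpace.exp_eq_tsum_div]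
  exact tsum_congr fun m => by rw [mul_pow]; ring

lemma integral_rpow_mul_exp_neg_mul_Ioc {b : ℝ} (hb : 0 < b) (a : ℝ) :
    ∫ s in Set.Ioc (0 : ℝ) 1, s ^ (b - 1) * Real.exp (-a * s) =
      ∑' m : ℕ, (-a) ^ m / m.factorial * (b + m)⁻¹ := by
  have hc (m : ℕ) : -1 < b - 1 + m := by
    have : (0 : ℝ) ≤ m := m.cast_nonneg
    linarith
  have hval (m : ℕ) : ∫ s in Set.Ioc (0 : ℝ) 1, s ^ (b - 1 + m) = (b + m)⁻¹ := by
    rw [integral_rpow_Ioc_zero_one (hc m)]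
    ring_nf
  have h := hasSum_integral_of_summable_integral_norm (μ := volume.restrict (Set.Ioc (0 : ℝ) 1))
    (F := fun (m : ℕ) (s : ℝ) => (-a) ^ m / m.factorial * s ^ (b - 1 + m))
    (fun m => (integrableOn_rpow_Ioc_zero_one (hc m)).const_mul _) ?_
  · simp only [integral_const_mul, hval] at h
    rw [h.tsum_eq]
    refine setIntegral_congr_fun measurableSet_Ioc fun s hs => ?_
    simp only [← tsum_pow_mul_div_factorial, ← tsum_mul_left]
    refine tsum_congr fun m => ?_
    rw [Real.rpow_add hs.1, Real.rpow_natCast]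
    ring
  · have hnorm (m : ℕ) : ∫ s in Set.Ioc (0 : ℝ) 1, ‖(-a) ^ m / m.factorial * s ^ (b - 1 + m)‖ =
        |a| ^ m / m.factorial * (b + m)⁻¹ := by
      rw [← hval m, ← integral_const_mul]
      refine setIntegral_congr_fun measurableSet_Ioc fun s hs => ?_
      simp [abs_of_nonneg (Real.rpow_nonneg hs.1.le _)]
    simp only [hnorm]
    refine Summable.of_nonneg_of_le (fun m => by positivity) (fun m => ?_)
      ((Real.summable_pow_div_factorial |a|).mul_right b⁻¹)
    gcongr
    linarith [(m.cast_nonneg : (0 : ℝ) ≤ m)]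

lemma gammaTail_eq_of_pos {b a : ℝ} (hb : 0 < b) (ha : 0 < a) :
    gammaTail b a = a ^ (-b) * Real.Gamma b - ∑' m : ℕ, (-a) ^ m / m.factorial * (b + m)⁻¹ := by
  have hint : IntegrableOn (fun s : ℝ => s ^ (b - 1) * Real.exp (-a * s)) (Set.Ioi 0) := by
    simpa using integrableOn_rpow_mul_exp_neg_mul_rpow (p := 1) (s := b - 1) (by linarith)
      one_pos ha
  have h := setIntegral_union (f := fun s : ℝ => s ^ (b - 1) * Real.exp (-a * s))
    (Set.Ioc_disjoint_Ioi (le_refl (1 : ℝ)) (a := (0 : ℝ))) measurableSet_Ioi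
    (hint.mono_set Set.Ioc_subset_Ioi_self) (hint.mono_set (Set.Ioi_subset_Ioi zero_le_one))
  rw [Set.Ioc_union_Ioi_eq_Ioi zero_le_one, integral_rpow_mul_exp_neg_mul_Ioc hb] at h
  have hG := Real.integral_rpow_mul_exp_neg_mul_Ioi hb ha
  simp only [← neg_mul] at hG
  rw [hG, one_div, Real.inv_rpow ha.le, ← Real.rpow_neg ha.le] at h
  rw [gammaTail, h]
  ring

lemma gammaTail_eq {b a : ℝ} (hb : ∀ n : ℤ, b ≠ n) (ha : 0 < a) :
    gammaTail b a = a ^ (-b) * Real.Gamma b - ∑' m : ℕ, (-a) ^ m / m.factorial * (b + m)⁻¹ := by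
  obtain ⟨n, hn⟩ := exists_nat_gt (-b)
  induction n generalizing b with
  | zero => exact gammaTail_eq_of_pos (by simpa using hn) ha
  | succ n ih =>
    have hb0 : b ≠ 0 := by simpa using hb 0
    have hb1 (k : ℤ) : b + 1 ≠ k := fun h => hb (k - 1) (by push_cast; linarith)
    have h1 := ih hb1 (by push_cast at hn; linarith)
    have h2 := gammaTail_add_one b ha
    have h3 := tsum_pow_div_factorial_mul_add_one hb (-a)
    rw [h1, Real.Gamma_add_one hb0, neg_add, Real.rpow_add ha, Real.rpow_neg_one] at h2
    refine mul_left_cancel₀ hb0 ?_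
    have h4 : a * (a ^ (-b) * a⁻¹ * (b * Real.Gamma b)) = b * (a ^ (-b) * Real.Gamma b) := by
      field_simp
    linear_combination -h2 + h3 + h4

lemma integrableOn_rpow_mul_exp_mul_exp_inv (b : ℝ) {a : ℝ} (ha : 0 < a) :
    IntegrableOn (fun s : ℝ => s ^ (b - 1) * Real.exp (-a * s) * Real.exp (-a * s⁻¹))
      (Set.Ioi 1) := by
  refine (integrableOn_rpow_mul_exp_neg_mul_Ioi_one (b - 1) ha).mul_bdd (c := 1) ?_ ?_
  · exact (by fun_prop : Measurable fun s : ℝ => Real.exp (-a * s⁻¹)).aestronglyMeasurable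
  · refine (ae_restrict_iff' measurableSet_Ioi).2 (Filter.Eventually.of_forall fun s hs => ?_)
    have hs0 : 0 < s := zero_lt_one.trans hs
    rw [Real.norm_eq_abs, Real.abs_exp, Real.exp_le_one_iff, neg_mul, neg_nonpos]
    positivity

lemma hasSum_integral_Ioi_one (b : ℝ) {a : ℝ} (ha : 0 < a) :
    HasSum (fun j : ℕ => (-a) ^ j / j.factorial * gammaTail (b - j) a)
      (∫ s in Set.Ioi (1 : ℝ), s ^ (b - 1) * Real.exp (-a * s) * Real.exp (-a * s⁻¹)) := by
  have hint (c : ℝ) := integrableOn_rpow_mul_exp_neg_mul_Ioi_one c ha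
  have h := hasSum_integral_of_summable_integral_norm (μ := volume.restrict (Set.Ioi (1 : ℝ)))
    (F := fun (j : ℕ) (s : ℝ) =>
      (-a) ^ j / j.factorial * (s ^ (b - j - 1) * Real.exp (-a * s)))
    (fun j => (hint _).const_mul _) ?_
  · simp only [integral_const_mul] at h
    have hexpand : Set.EqOn
        (fun s : ℝ => ∑' j : ℕ, (-a) ^ j / j.factorial * (s ^ (b - j - 1) * Real.exp (-a * s)))
        (fun s => s ^ (b - 1) * Real.exp (-a * s) * Real.exp (-a * s⁻¹)) (Set.Ioi 1) := by
      intro s hs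
      have hs0 : 0 < s := zero_lt_one.trans hs
      simp only [← tsum_pow_mul_div_factorial (-a) s⁻¹, ← tsum_mul_left]
      refine tsum_congr fun j => ?_
      rw [sub_right_comm, Real.rpow_sub hs0 (b - 1), Real.rpow_natCast, inv_pow]
      ring
    rwa [setIntegral_congr_fun measurableSet_Ioi hexpand] at h
  · have hnorm (j : ℕ) : ∫ s in Set.Ioi (1 : ℝ),
        ‖(-a) ^ j / j.factorial * (s ^ (b - j - 1) * Real.exp (-a * s))‖ =
        a ^ j / j.factorial * gammaTail (b - j) a := by
      rw [gammaTail, ← integral_const_mul]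
      refine setIntegral_congr_fun measurableSet_Ioi fun s hs => ?_
      have hs0 : 0 < s := zero_lt_one.trans hs
      simp [abs_of_pos ha, abs_of_nonneg (Real.rpow_nonneg hs0.le _)]
    simp only [hnorm]
    refine Summable.of_nonneg_of_le (fun j => ?_) (fun j => ?_)
      ((Real.summable_pow_div_factorial a).mul_right (gammaTail b a))
    · refine mul_nonneg (by positivity) (setIntegral_nonneg measurableSet_Ioi fun s hs => ?_)
      have hs0 : 0 < s := zero_lt_one.trans hs
      positivity
    · refine mul_le_mul_of_nonneg_left ?_ (by positivity)
      refine setIntegral_mono_on (hint _) (hint _) measurableSet_Ioi fun s hs => ?_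
      have hs1 : 1 ≤ s := le_of_lt hs
      gcongr
      linarith [(j.cast_nonneg : (0 : ℝ) ≤ j)]

lemma integral_Ioi_zero_eq_add (ν : ℝ) {a : ℝ} (ha : 0 < a) :
    ∫ s in Set.Ioi (0 : ℝ), s ^ (ν - 1) * Real.exp (-a * s) * Real.exp (-a * s⁻¹) =
      (∫ s in Set.Ioi (1 : ℝ), s ^ (ν - 1) * Real.exp (-a * s) * Real.exp (-a * s⁻¹)) +
      ∫ s in Set.Ioi (1 : ℝ), s ^ (-ν - 1) * Real.exp (-a * s) * Real.exp (-a * s⁻¹) := by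
  set g : ℝ → ℝ := fun s => s ^ (ν - 1) * Real.exp (-a * s) * Real.exp (-a * s⁻¹) with hg
  have himage : (fun s : ℝ => s⁻¹) '' Set.Ioi 1 = Set.Ioo 0 1 := by
    have := Set.inv_Ioi₀ (zero_lt_one (α := ℝ))
    rw [inv_one] at this
    rw [← this]
    exact Set.image_inv_eq_inv
  have hderiv : ∀ s ∈ Set.Ioi (1 : ℝ),
      HasDerivWithinAt (fun s : ℝ => s⁻¹) (-(s ^ 2)⁻¹) (Set.Ioi 1) s := fun s hs =>
    (hasDerivAt_inv (zero_lt_one.trans hs).ne').hasDerivWithinAt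
  have hinj : Set.InjOn (fun s : ℝ => s⁻¹) (Set.Ioi 1) := inv_injective.injOn
  have hcongr : Set.EqOn (fun s : ℝ => |-(s ^ 2)⁻¹| • g s⁻¹)
      (fun s => s ^ (-ν - 1) * Real.exp (-a * s) * Real.exp (-a * s⁻¹)) (Set.Ioi 1) := by
    intro s hs
    have hs0 : 0 < s := zero_lt_one.trans hs
    have hpow : (s ^ 2)⁻¹ * (s⁻¹) ^ (ν - 1) = s ^ (-ν - 1) := by
      rw [Real.inv_rpow hs0.le, ← Real.rpow_neg hs0.le, ← Real.rpow_natCast,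
        ← Real.rpow_neg hs0.le, ← Real.rpow_add hs0]
      congr 1
      push_cast
      ring
    simp only [hg, abs_neg, smul_eq_mul, inv_inv]
    rw [abs_of_nonneg (by positivity), ← hpow]
    ring
  have hIoo : IntegrableOn g (Set.Ioo 0 1) := by
    rw [← himage, integrableOn_image_iff_integrableOn_abs_deriv_smul measurableSet_Ioi hderiv hinj,
      integrableOn_congr_fun hcongr measurableSet_Ioi]
    exact integrableOn_rpow_mul_exp_mul_exp_inv (-ν) ha
  have hval := integral_image_eq_integral_abs_deriv_smul measurableSet_Ioi hderiv hinj g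
  rw [himage, setIntegral_congr_fun measurableSet_Ioi hcongr] at hval
  rw [← Set.Ioc_union_Ioi_eq_Ioi zero_le_one,
    setIntegral_union (Set.Ioc_disjoint_Ioi le_rfl) measurableSet_Ioi
      ((integrableOn_Ioc_iff_integrableOn_Ioo (f := g)).2 hIoo) (integrableOn_rpow_mul_exp_mul_exp_inv ν ha),
    integral_Ioc_eq_integral_Ioo, hval, add_comm]

lemma besselK_eq_integral_Ioi_one_add (ν : ℝ) {z : ℝ} (hz : 0 < z) :
    besselK ν z = 1 / 2 *
      ((∫ s in Set.Ioi (1 : ℝ), s ^ (ν - 1) * Real.exp (-(z / 2) * s) *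
          Real.exp (-(z / 2) * s⁻¹)) +
        ∫ s in Set.Ioi (1 : ℝ), s ^ (-ν - 1) * Real.exp (-(z / 2) * s) *
          Real.exp (-(z / 2) * s⁻¹)) := by
  rw [besselK, ← integral_Ioi_zero_eq_add ν (half_pos hz)]
  congr 2 with s
  rw [mul_assoc (s ^ (ν - 1)), ← Real.exp_add]
  ring_nf

lemma summable_pow_div_factorial_mul_prod {ν : ℝ} (hν : ∀ n : ℤ, ν ≠ n) (x : ℝ) :
    Summable fun p : ℕ × ℕ =>
      x ^ p.1 / p.1.factorial * (x ^ p.2 / p.2.factorial * (ν - p.1 + p.2)⁻¹) := by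
  obtain ⟨C, hC⟩ := exists_abs_inv_add_int_le hν
  have h := (Real.summable_pow_div_factorial |x|).mul_of_nonneg
    (Real.summable_pow_div_factorial |x|) (fun _ => by positivity) (fun _ => by positivity)
  refine Summable.of_norm_bounded (h.mul_right C) fun p => ?_
  rw [Real.norm_eq_abs, abs_mul, abs_mul, abs_div, abs_div, abs_pow, abs_pow, Nat.abs_cast,
    Nat.abs_cast, ← mul_assoc]
  gcongr
  have := hC (p.2 - p.1)
  push_cast at this
  rwa [sub_add_eq_add_sub, add_sub_assoc]

/-- The double series left over from the two halves of the integral cancel each other. -/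
lemma exists_hasSum_antisymm {ν : ℝ} (hν : ∀ n : ℤ, ν ≠ n) (x : ℝ) :
    ∃ T : ℝ,
      HasSum (fun j : ℕ => x ^ j / j.factorial *
        ∑' m : ℕ, x ^ m / m.factorial * (ν - j + m)⁻¹) T ∧
      HasSum (fun j : ℕ => x ^ j / j.factorial *
        ∑' m : ℕ, x ^ m / m.factorial * (-ν - j + m)⁻¹) (-T) := by
  have hν' (n : ℤ) : -ν ≠ n := fun h => hν (-n) (by push_cast; linarith)
  have hsub {μ : ℝ} (hμ : ∀ n : ℤ, μ ≠ n) (j : ℕ) (n : ℤ) : μ - j ≠ n :=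
    fun h => hμ (n + j) (by push_cast; linarith)
  have h1 := (summable_pow_div_factorial_mul_prod hν x).hasSum
  refine ⟨_, h1.prod_fiberwise fun j =>
    (summable_pow_div_factorial_mul_add (hsub hν j) x).hasSum.mul_left _, ?_⟩
  have h2 := ((Equiv.prodComm ℕ ℕ).hasSum_iff.2 h1).neg
  refine HasSum.prod_fiberwise (f := fun p : ℕ × ℕ =>
      x ^ p.1 / p.1.factorial * (x ^ p.2 / p.2.factorial * (-ν - p.1 + p.2)⁻¹)) ?_ fun j =>
    (summable_pow_div_factorial_mul_add (hsub hν' j) x).hasSum.mul_left _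
  refine h2.congr_fun fun p => ?_
  have : -ν - p.1 + p.2 = -(ν - p.2 + p.1) := by ring
  simp only [this, inv_neg, Function.comp_apply, Equiv.prodComm_apply, Prod.fst_swap,
    Prod.snd_swap]
  ring

lemma real_sin_pi_mul_ne_zero {ν : ℝ} (hν : ∀ n : ℤ, ν ≠ n) : Real.sin (π * ν) ≠ 0 := fun h => by
  obtain ⟨n, hn⟩ := Real.sin_eq_zero_iff.1 h
  exact hν n (mul_left_cancel₀ Real.pi_ne_zero (by linarith))

lemma Gamma_sub_nat_eq {ν : ℝ} (hν : ∀ n : ℤ, ν ≠ n) (j : ℕ) :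
    Real.Gamma (ν - j) = (-1) ^ j * (π / Real.sin (π * ν)) / Real.Gamma (j + 1 - ν) := by
  have hG : Real.Gamma (j + 1 - ν) ≠ 0 := Real.Gamma_ne_zero fun m h =>
    hν (j + 1 + m) (by push_cast; linarith)
  have h := Real.Gamma_mul_Gamma_one_sub (ν - j)
  rw [show 1 - (ν - j) = j + 1 - ν by ring,
    show π * (ν - j) = π * ν - j * π by ring, Real.sin_sub_nat_mul_pi] at h
  rw [eq_div_iff hG, h, div_mul_eq_div_div, div_right_comm, mul_comm ((-1 : ℝ) ^ j)]
  rcases neg_one_pow_eq_or ℝ j with h | h <;> simp [h, div_neg]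

lemma pow_div_factorial_mul_Gamma_sub {ν a : ℝ} (hν : ∀ n : ℤ, ν ≠ n) (ha : 0 < a) (j : ℕ) :
    (-a) ^ j / j.factorial * (a ^ (-(ν - j)) * Real.Gamma (ν - j)) =
      π / Real.sin (π * ν) *
        (a ^ (2 * (j : ℝ) - ν) / (j.factorial * Real.Gamma (j + 1 - ν))) := by
  have hpow : a ^ (2 * (j : ℝ) - ν) = a ^ j * a ^ (-(ν - j)) := by
    rw [← Real.rpow_natCast, ← Real.rpow_add ha]
    ring_nf
  have hsq : (-1 : ℝ) ^ j * (-1) ^ j = 1 := by rw [← mul_pow]; simp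
  rw [Gamma_sub_nat_eq hν, hpow, neg_pow]
  linear_combination (a ^ j * a ^ (-(ν - j)) / j.factorial * (π / Real.sin (π * ν)) /
    Real.Gamma (j + 1 - ν)) * hsq

lemma hasSum_series_of_hasSum_tail {ν a T : ℝ} (hν : ∀ n : ℤ, ν ≠ n) (ha : 0 < a)
    (hT : HasSum (fun j : ℕ => (-a) ^ j / j.factorial *
      ∑' m : ℕ, (-a) ^ m / m.factorial * (ν - j + m)⁻¹) T) :
    HasSum (fun j : ℕ => a ^ (2 * (j : ℝ) - ν) / (j.factorial * Real.Gamma (j + 1 - ν)))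
      (Real.sin (π * ν) / π *
        ((∫ s in Set.Ioi (1 : ℝ), s ^ (ν - 1) * Real.exp (-a * s) * Real.exp (-a * s⁻¹)) + T)) := by
  have hsin := real_sin_pi_mul_ne_zero hν
  have h := ((hasSum_integral_Ioi_one ν ha).add hT).mul_left (Real.sin (π * ν) / π)
  refine h.congr_fun fun j => ?_
  rw [gammaTail_eq (fun n h => hν (n + j) (by push_cast; linarith)) ha, mul_sub, sub_add_cancel,
    pow_div_factorial_mul_Gamma_sub hν ha, ← mul_assoc, div_mul_div_cancel₀ Real.pi_ne_zero,
    div_self hsin, one_mul]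

/-- For non-integer `ν` and `z > 0`,
`K_ν(z) = (π / (2 sin(πν))) · [ Σ_{j=0}^∞ (z/2)^{2j−ν} / (j! Γ(j+1−ν))
  − Σ_{j=0}^∞ (z/2)^{2j+ν} / (j! Γ(j+1+ν)) ]`, both series converging absolutely. -/
theorem besselK_series_of_not_int (ν z : ℝ) (hν : ∀ n : ℤ, ν ≠ (n : ℝ)) (hz : 0 < z) :
    (Summable fun j : ℕ =>
      |(z / 2) ^ (2 * (j : ℝ) - ν) / ((j.factorial : ℝ) * Real.Gamma ((j : ℝ) + 1 - ν))|) ∧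
    (Summable fun j : ℕ =>
      |(z / 2) ^ (2 * (j : ℝ) + ν) / ((j.factorial : ℝ) * Real.Gamma ((j : ℝ) + 1 + ν))|) ∧
    besselK ν z = (π / (2 * Real.sin (π * ν))) *
      ((∑' j : ℕ, (z / 2) ^ (2 * (j : ℝ) - ν) / ((j.factorial : ℝ) * Real.Gamma ((j : ℝ) + 1 - ν)))
      - ∑' j : ℕ, (z / 2) ^ (2 * (j : ℝ) + ν) / ((j.factorial : ℝ) * Real.Gamma ((j : ℝ) + 1 + ν))) := by
  have hν' (n : ℤ) : -ν ≠ n := fun h => hν (-n) (by push_cast; linarith)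
  have hsin := real_sin_pi_mul_ne_zero hν
  obtain ⟨T, hT, hT'⟩ := exists_hasSum_antisymm hν (-(z / 2))
  have h1 := hasSum_series_of_hasSum_tail hν (half_pos hz) hT
  have h2 := hasSum_series_of_hasSum_tail hν' (half_pos hz) hT'
  simp only [sub_neg_eq_add, mul_neg, Real.sin_neg] at h2
  refine ⟨h1.summable.abs, h2.summable.abs, ?_⟩
  rw [h1.tsum_eq, h2.tsum_eq, besselK_eq_integral_Ioi_one_add ν hz]
  generalize Real.sin (π * ν) = σ at hsin ⊢
  field_simp
  ring
end

section
/- For every α > 0, every ϰ ≥ 0 and every t ∈ ℝ, the function f_{α,ϰ} is integrable on ℝ and ∫_ℝ e^{iλt} f_{α,ϰ}(λ) dλ = cos(ϰ t)/(1 + t²)^{α/2}; that is, f_{α,ϰ} is the spectral density of the covariance function B_{α,ϰ}(t) = cos(ϰ t)/(1 + t²)^{α/2}. -/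
open MeasureTheory Real

/-- `c₁(α) = 2^((1−α)/2)/(√π Γ(α/2))`. -/
noncomputable def c1 (α : ℝ) : ℝ := 2 ^ ((1 - α) / 2) / (Real.sqrt π * Real.Gamma (α / 2))

/-- The spectral density
`f_{α,ϰ}(λ) = (c₁(α)/2)[K_{(α−1)/2}(|λ+ϰ|)|λ+ϰ|^{(α−1)/2} + K_{(α−1)/2}(|λ−ϰ|)|λ−ϰ|^{(α−1)/2}]`. -/
noncomputable def specDens (α κ l : ℝ) : ℝ :=
  (c1 α / 2) * (besselK ((α - 1) / 2) |l + κ| * |l + κ| ^ ((α - 1) / 2)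
    + besselK ((α - 1) / 2) |l - κ| * |l - κ| ^ ((α - 1) / 2))

/-- The integrand of the representation of `K_ν(|x|)|x|^ν` as a mixture of Gaussians in `x`. -/
noncomputable def besselGaussianMixture (ν x u : ℝ) : ℝ :=
  u ^ (ν - 1) * Real.exp (-u) * Real.exp (-(4 * u)⁻¹ * x ^ 2)

/-- `K_ν(x) x^ν = 2^(ν-1) ∫₀^∞ u^(ν-1) exp(-u - x²/(4u)) du` for `x > 0`. -/
theorem besselK_mul_rpow (ν : ℝ) {x : ℝ} (hx : 0 < x) :
    besselK ν x * x ^ ν =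
      2 ^ (ν - 1) * ∫ u in Set.Ioi (0 : ℝ), besselGaussianMixture ν x u := by
  have hb : 0 < x / 2 := by positivity
  have hscale := integral_comp_mul_left_Ioi (besselGaussianMixture ν x) 0 hb
  have hintegrand : ∫ s in Set.Ioi (0 : ℝ), besselGaussianMixture ν x (x / 2 * s) =
      (x / 2) ^ (ν - 1) *
        ∫ s in Set.Ioi (0 : ℝ), s ^ (ν - 1) * Real.exp (-(1 / 2) * (s + 1 / s) * x) := by
    rw [← integral_const_mul]
    refine setIntegral_congr_fun measurableSet_Ioi fun s hs => ?_
    have hs : 0 < s := hs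
    simp only [besselGaussianMixture]
    rw [Real.mul_rpow hb.le hs.le, mul_assoc, ← Real.exp_add, mul_assoc]
    congr 3
    field_simp
    ring
  rw [hintegrand, mul_zero, smul_eq_mul] at hscale
  have hint : ∫ u in Set.Ioi (0 : ℝ), besselGaussianMixture ν x u =
      (x / 2) ^ ν *
        ∫ s in Set.Ioi (0 : ℝ), s ^ (ν - 1) * Real.exp (-(1 / 2) * (s + 1 / s) * x) := by
    rw [Real.rpow_sub_one hb.ne'] at hscale
    field_simp at hscale ⊢
    linarith
  rw [hint, besselK, Real.div_rpow hx.le zero_le_two, Real.rpow_sub_one two_ne_zero]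
  generalize (∫ s in Set.Ioi (0 : ℝ), s ^ (ν - 1) * Real.exp (-(1 / 2) * (s + 1 / s) * x)) = J
  field_simp

theorem ae_besselK_abs_mul_rpow_abs (ν : ℝ) :
    (fun x : ℝ => 2 ^ (ν - 1) * ∫ u in Set.Ioi (0 : ℝ), besselGaussianMixture ν x u) =ᵐ[volume]
      fun x => besselK ν |x| * |x| ^ ν := by
  filter_upwards [Measure.ae_ne volume (0 : ℝ)] with x hx
  rw [besselK_mul_rpow ν (abs_pos.mpr hx)]
  simp [besselGaussianMixture]

theorem measurable_besselGaussianMixture (ν : ℝ) :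
    Measurable (Function.uncurry (besselGaussianMixture ν)) := by
  unfold besselGaussianMixture Function.uncurry
  fun_prop

theorem besselGaussianMixture_nonneg (ν x : ℝ) {u : ℝ} (hu : 0 < u) :
    0 ≤ besselGaussianMixture ν x u := by
  unfold besselGaussianMixture
  positivity

theorem integral_besselGaussianMixture (ν : ℝ) {u : ℝ} (hu : 0 < u) :
    ∫ x, besselGaussianMixture ν x u =
      2 * √π * (u ^ (ν + 1 / 2 - 1) * Real.exp (-(1 * u))) := by
  simp only [besselGaussianMixture]
  rw [integral_const_mul, integral_gaussian, div_inv_eq_mul,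
    show π * (4 * u) = 2 ^ 2 * π * u by ring, Real.sqrt_mul (by positivity),
    Real.sqrt_mul (by positivity), Real.sqrt_sq zero_le_two, Real.sqrt_eq_rpow u,
    show ν + 1 / 2 - 1 = (ν - 1) + 1 / 2 by ring, Real.rpow_add hu, one_mul]
  ring

theorem integrable_besselGaussianMixture {ν : ℝ} (hν : 0 < ν + 1 / 2) :
    Integrable (Function.uncurry (besselGaussianMixture ν))
      (volume.prod (volume.restrict (Set.Ioi 0))) := by
  rw [integrable_prod_iff' (measurable_besselGaussianMixture ν).aestronglyMeasurable]
  constructor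
  · filter_upwards [ae_restrict_mem measurableSet_Ioi] with u hu
    have hu : 0 < u := hu
    exact (integrable_exp_neg_mul_sq (by positivity : 0 < (4 * u)⁻¹)).const_mul
      (u ^ (ν - 1) * Real.exp (-u))
  · have hgamma : IntegrableOn
        (fun u : ℝ => 2 * √π * (u ^ (ν + 1 / 2 - 1) * Real.exp (-(1 * u)))) (Set.Ioi 0) := by
      refine Integrable.const_mul ?_ _
      simpa [mul_comm, IntegrableOn] using Real.GammaIntegral_convergent hν
    refine hgamma.congr ?_
    filter_upwards [ae_restrict_mem measurableSet_Ioi] with u hu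
    rw [← integral_besselGaussianMixture ν hu]
    exact integral_congr_ae (.of_forall fun x =>
      (Real.norm_of_nonneg (besselGaussianMixture_nonneg ν x hu)).symm)

theorem integrable_besselK_abs_mul_rpow_abs {ν : ℝ} (hν : 0 < ν + 1 / 2) :
    Integrable fun x : ℝ => besselK ν |x| * |x| ^ ν :=
  ((integrable_besselGaussianMixture hν).integral_prod_left.const_mul _).congr
    (ae_besselK_abs_mul_rpow_abs ν)

theorem fourier_besselGaussianMixture (ν t : ℝ) {u : ℝ} (hu : 0 < u) :
    ∫ x : ℝ, Complex.exp (Complex.I * x * t) * (besselGaussianMixture ν x u : ℂ) =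
      ((2 * √π * (u ^ (ν + 1 / 2 - 1) * Real.exp (-((1 + t ^ 2) * u))) : ℝ) : ℂ) := by
  have hre : 0 < (((4 * u)⁻¹ : ℝ) : ℂ).re := by
    rw [Complex.ofReal_re]
    positivity
  have hgauss := fourierIntegral_gaussian hre (t : ℂ)
  have hroot : ((π : ℂ) / ((4 * u)⁻¹ : ℝ)) ^ (1 / 2 : ℂ) = ((2 * √π * u ^ (1 / 2 : ℝ) : ℝ) : ℂ) := by
    rw [← Complex.ofReal_div, show (1 / 2 : ℂ) = ((1 / 2 : ℝ) : ℂ) by push_cast; rfl,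
      ← Complex.ofReal_cpow (by positivity), div_inv_eq_mul,
      show π * (4 * u) = 2 ^ 2 * π * u by ring, ← Real.sqrt_eq_rpow,
      Real.sqrt_mul (by positivity), Real.sqrt_mul (by positivity), Real.sqrt_sq zero_le_two,
      Real.sqrt_eq_rpow u]
  have hexp : Complex.exp (-(t : ℂ) ^ 2 / (4 * ((4 * u)⁻¹ : ℝ))) =
      (Real.exp (-(t ^ 2 * u)) : ℂ) := by
    have hu' : (u : ℂ) ≠ 0 := by exact_mod_cast hu.ne'
    push_cast
    congr 1
    field_simp
  rw [hroot, hexp, ← Complex.ofReal_mul] at hgauss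
  calc
    _ = ∫ x : ℝ, ((u ^ (ν - 1) * Real.exp (-u) : ℝ) : ℂ) *
        (Complex.exp (Complex.I * t * x) * Complex.exp (-((4 * u)⁻¹ : ℝ) * x ^ 2)) := by
      congr 1
      ext x
      simp only [besselGaussianMixture]
      push_cast
      rw [mul_right_comm Complex.I]
      ring
    _ = _ := by
      rw [integral_const_mul, hgauss, ← Complex.ofReal_mul,
        show ν + 1 / 2 - 1 = (ν - 1) + 1 / 2 by ring, Real.rpow_add hu,
        show -((1 + t ^ 2) * u) = -u + -(t ^ 2 * u) by ring, Real.exp_add]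
      congr 1
      ring

theorem norm_cexp_I_mul_ofReal_mul_ofReal (x t : ℝ) :
    ‖Complex.exp (Complex.I * x * t)‖ = 1 := by
  rw [mul_assoc, mul_comm, ← Complex.ofReal_mul, Complex.norm_exp_ofReal_mul_I]

theorem integrable_cexp_mul_ofReal {μ : Measure ℝ} {f : ℝ → ℝ} (hf : Integrable f μ) (t : ℝ) :
    Integrable (fun x : ℝ => Complex.exp (Complex.I * x * t) * (f x : ℂ)) μ :=
  hf.ofReal.bdd_mul (c := 1) (by fun_prop)
    (.of_forall fun x => (norm_cexp_I_mul_ofReal_mul_ofReal x t).le)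

/-- The Fourier transform of `K_ν(|x|)|x|^ν`, for `ν > -1/2`. -/
theorem fourier_besselK_abs_mul_rpow_abs {ν : ℝ} (hν : 0 < ν + 1 / 2) (t : ℝ) :
    ∫ x : ℝ, Complex.exp (Complex.I * x * t) * ((besselK ν |x| * |x| ^ ν : ℝ) : ℂ) =
      ((2 ^ ν * √π * Real.Gamma (ν + 1 / 2) / (1 + t ^ 2) ^ (ν + 1 / 2) : ℝ) : ℂ) := by
  have hpos : 0 < 1 + t ^ 2 := by positivity
  have hprod : Integrable (Function.uncurry fun x u : ℝ =>
      Complex.exp (Complex.I * x * t) * (besselGaussianMixture ν x u : ℂ))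
      (volume.prod (volume.restrict (Set.Ioi 0))) :=
    (integrable_besselGaussianMixture hν).ofReal.bdd_mul (c := 1)
      (f := fun p : ℝ × ℝ => Complex.exp (Complex.I * p.1 * t)) (by fun_prop)
      (.of_forall fun p => (norm_cexp_I_mul_ofReal_mul_ofReal p.1 t).le)
  calc
    _ = ∫ x : ℝ, ((2 ^ (ν - 1) : ℝ) : ℂ) * ∫ u in Set.Ioi (0 : ℝ),
        Complex.exp (Complex.I * x * t) * (besselGaussianMixture ν x u : ℂ) := by
      refine integral_congr_ae ?_
      filter_upwards [ae_besselK_abs_mul_rpow_abs ν] with x hx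
      rw [← hx, integral_const_mul, Complex.ofReal_mul, ← integral_complex_ofReal]
      ring
    _ = ((2 ^ (ν - 1) : ℝ) : ℂ) * ∫ u in Set.Ioi (0 : ℝ),
        ((2 * √π * (u ^ (ν + 1 / 2 - 1) * Real.exp (-((1 + t ^ 2) * u))) : ℝ) : ℂ) := by
      rw [integral_const_mul, integral_integral_swap hprod]
      congr 1
      exact setIntegral_congr_fun measurableSet_Ioi fun u hu =>
        fourier_besselGaussianMixture ν t hu
    _ = _ := by
      rw [integral_complex_ofReal, integral_const_mul,
        Real.integral_rpow_mul_exp_neg_mul_Ioi hν hpos, ← Complex.ofReal_mul,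
        Real.div_rpow zero_le_one hpos.le, Real.one_rpow, Real.rpow_sub_one two_ne_zero]
      congr 1
      field_simp

theorem fourier_comp_add_right (f : ℝ → ℂ) (a t : ℝ) :
    ∫ x : ℝ, Complex.exp (Complex.I * x * t) * f (x + a) =
      Complex.exp (-(a * t) * Complex.I) * ∫ x : ℝ, Complex.exp (Complex.I * x * t) * f x := by
  rw [← integral_const_mul, ← integral_add_right_eq_self (fun x : ℝ =>
    Complex.exp (-(a * t) * Complex.I) * (Complex.exp (Complex.I * x * t) * f x)) a]
  congr 1
  ext x
  rw [← mul_assoc, ← Complex.exp_add]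
  congr 2
  push_cast
  ring

/-- For every `α > 0`, `ϰ ≥ 0` and `t ∈ ℝ`, the spectral density `f_{α,ϰ}` is integrable on `ℝ`
and `∫_ℝ e^{iλt} f_{α,ϰ}(λ) dλ = cos(ϰt)/(1+t²)^{α/2}`; i.e. `f_{α,ϰ}` is the spectral density
of the covariance function `B_{α,ϰ}(t) = cos(ϰt)/(1+t²)^{α/2}`. -/
theorem specDens_is_spectral_density_of_covariance (α κ t : ℝ) (hα : 0 < α) (hκ : 0 ≤ κ) :
    Integrable (fun l : ℝ => specDens α κ l) ∧
    ∫ l : ℝ, Complex.exp (Complex.I * l * t) * (specDens α κ l : ℂ) =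
      ((Real.cos (κ * t) / (1 + t ^ 2) ^ (α / 2) : ℝ) : ℂ) := by
  have hν : 0 < (α - 1) / 2 + 1 / 2 := by linarith
  set g : ℝ → ℝ := fun x => besselK ((α - 1) / 2) |x| * |x| ^ ((α - 1) / 2)
  have hg_int : Integrable g := integrable_besselK_abs_mul_rpow_abs hν
  have hplus : Integrable fun l => g (l + κ) := hg_int.comp_add_right κ
  have hminus : Integrable fun l => g (l + -κ) := hg_int.comp_add_right (-κ)
  have hspec (l : ℝ) : specDens α κ l = c1 α / 2 * (g (l + κ) + g (l + -κ)) := rfl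
  refine ⟨?_, ?_⟩
  · simp_rw [hspec]
    exact (hplus.add hminus).const_mul _
  · have hfourier := fourier_besselK_abs_mul_rpow_abs hν t
    have hsplit (l : ℝ) : Complex.exp (Complex.I * l * t) * (specDens α κ l : ℂ) =
        ((c1 α / 2 : ℝ) : ℂ) * (Complex.exp (Complex.I * l * t) * (g (l + κ) : ℂ) +
          Complex.exp (Complex.I * l * t) * (g (l + -κ) : ℂ)) := by
      rw [hspec]
      push_cast
      ring
    simp_rw [hsplit]
    rw [integral_const_mul, integral_add (integrable_cexp_mul_ofReal hplus t)
        (integrable_cexp_mul_ofReal hminus t),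
      fourier_comp_add_right (fun x => (g x : ℂ)), fourier_comp_add_right (fun x => (g x : ℂ)),
      hfourier, ← add_mul]
    have hcos : Complex.exp (-((κ : ℝ) * t) * Complex.I) +
        Complex.exp (-((-κ : ℝ) * t) * Complex.I) = ((2 * Real.cos (κ * t) : ℝ) : ℂ) := by
      push_cast
      rw [Complex.two_cos, add_comm]
      simp
    rw [hcos, ← Complex.ofReal_mul, ← Complex.ofReal_mul]
    congr 1
    have hΓ : Real.Gamma (α / 2) ≠ 0 := (Real.Gamma_pos_of_pos (by positivity)).ne'
    have hpow : (1 + t ^ 2) ^ (α / 2) ≠ 0 := by positivity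
    rw [c1, show (1 - α) / 2 = -((α - 1) / 2) by ring, Real.rpow_neg zero_le_two,
      show (α - 1) / 2 + 1 / 2 = α / 2 by ring]
    field_simp
end

section
/- For every α > 0 and ϰ ≥ 0, the function B_{α,ϰ}(t) = cos(ϰ t)/(1 + t²)^{α/2} is a positive-definite function on ℝ: for all n, all t_1, …, t_n ∈ ℝ and all complex c_1, …, c_n, Σ_{j,k} c_j \overline{c_k} B_{α,ϰ}(t_j − t_k) ≥ 0. Consequently any convex combination B(t) = Σ_{j=0}^κ D_j cos(ϰ_j t)/(1+t²)^{α_j/2} with D_j ≥ 0, Σ_j D_j = 1, α_j > 0, ϰ_j ≥ 0 is a valid covariance function of a stationary process with B(0) = 1. -/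
open MeasureTheory Real

/-- The covariance function `B_{α,ϰ}(t) = cos(ϰt)/(1+t²)^{α/2}`. -/
noncomputable def covB (α κ t : ℝ) : ℝ := Real.cos (κ * t) / (1 + t ^ 2) ^ (α / 2)

/-- A real function `B` is positive definite if for all `n`, all `t₁,…,tₙ ∈ ℝ` and all complex
`c₁,…,cₙ`, the Hermitian form `Σ_{j,k} c_j conj(c_k) B(t_j − t_k)` is a nonnegative real. -/
def IsPosDefFn (B : ℝ → ℝ) : Prop :=
  ∀ (n : ℕ) (t : Fin n → ℝ) (c : Fin n → ℂ),
    0 ≤ (∑ j, ∑ k, c j * (starRingEnd ℂ) (c k) * (B (t j - t k) : ℂ)).re ∧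
    (∑ j, ∑ k, c j * (starRingEnd ℂ) (c k) * (B (t j - t k) : ℂ)).im = 0

open scoped ComplexOrder ComplexConjugate

/-- A complex-valued function on `ℝ` is positive definite if all its Hermitian forms are
nonnegative (in particular real). -/
def IsComplexPosDef (φ : ℝ → ℂ) : Prop :=
  ∀ (n : ℕ) (t : Fin n → ℝ) (c : Fin n → ℂ),
    0 ≤ ∑ j, ∑ k, c j * conj (c k) * φ (t j - t k)

theorem isPosDefFn_iff_isComplexPosDef (B : ℝ → ℝ) :
    IsPosDefFn B ↔ IsComplexPosDef (fun t => (B t : ℂ)) := by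
  simp only [IsPosDefFn, IsComplexPosDef, Complex.nonneg_iff, eq_comm (a := (0 : ℝ))]

namespace IsComplexPosDef

theorem add {φ ψ : ℝ → ℂ} (hφ : IsComplexPosDef φ) (hψ : IsComplexPosDef ψ) :
    IsComplexPosDef (fun t => φ t + ψ t) := by
  intro n t c
  simpa only [mul_add, Finset.sum_add_distrib] using add_nonneg (hφ n t c) (hψ n t c)

theorem const_mul {φ : ℝ → ℂ} (hφ : IsComplexPosDef φ) {a : ℂ} (ha : 0 ≤ a) :
    IsComplexPosDef (fun t => a * φ t) := by
  intro n t c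
  have h := mul_nonneg ha (hφ n t c)
  simp only [Finset.mul_sum] at h
  convert h using 1
  refine Finset.sum_congr rfl fun j _ => Finset.sum_congr rfl fun k _ => ?_
  ring

theorem sum {ι : Type*} (s : Finset ι) {φ : ι → ℝ → ℂ} (hφ : ∀ i ∈ s, IsComplexPosDef (φ i)) :
    IsComplexPosDef (fun t => ∑ i ∈ s, φ i t) := by
  classical
  induction s using Finset.induction_on with
  | empty => intro n t c; simp
  | insert i s hi ih =>
    simp only [Finset.sum_insert hi]
    exact (hφ i (Finset.mem_insert_self i s)).add
      (ih fun j hj => hφ j (Finset.mem_insert_of_mem hj))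

theorem one : IsComplexPosDef (fun _ => 1) := by
  intro n t c
  have h : ∑ j, ∑ k, c j * conj (c k) * 1 = (∑ j, c j) * conj (∑ j, c j) := by
    rw [map_sum, Finset.sum_mul_sum]
    simp
  rw [h]
  exact mul_star_self_nonneg _

/-- Positive definiteness is preserved under multiplication by a character. -/
theorem exp_mul {φ : ℝ → ℂ} (hφ : IsComplexPosDef φ) (x : ℝ) :
    IsComplexPosDef (fun t => Complex.exp (t * x * Complex.I) * φ t) := by
  intro n t c
  convert hφ n t (fun j => c j * Complex.exp (t j * x * Complex.I)) using 1
  refine Finset.sum_congr rfl fun j _ => Finset.sum_congr rfl fun k _ => ?_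
  rw [map_mul, ← Complex.exp_conj]
  simp only [map_mul, Complex.conj_ofReal, Complex.conj_I]
  rw [Complex.ofReal_sub, show ((t j : ℂ) - t k) * x * Complex.I
    = t j * x * Complex.I + t k * x * -Complex.I by ring, Complex.exp_add]
  ring

theorem cos_mul {φ : ℝ → ℂ} (hφ : IsComplexPosDef φ) (x : ℝ) :
    IsComplexPosDef (fun t => (Real.cos (x * t) : ℂ) * φ t) := by
  have h := ((hφ.exp_mul x).add (hφ.exp_mul (-x))).const_mul
    (a := 1 / 2) (by positivity)
  convert h using 2 with t
  rw [Complex.ofReal_cos, Complex.cos]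
  push_cast
  ring_nf

/-- Integrals of positive definite functions over a parameter are positive definite. -/
theorem integral {X : Type*} [MeasurableSpace X] {μ : Measure X} {F : X → ℝ → ℂ}
    (hF : ∀ᵐ x ∂μ, IsComplexPosDef (F x)) (hint : ∀ t, Integrable (fun x => F x t) μ) :
    IsComplexPosDef (fun t => ∫ x, F x t ∂μ) := by
  intro n t c
  have h : ∑ j, ∑ k, c j * conj (c k) * ∫ x, F x (t j - t k) ∂μ
      = ∫ x, ∑ j, ∑ k, c j * conj (c k) * F x (t j - t k) ∂μ := by
    rw [integral_finsetSum _ fun j _ => integrable_finsetSum _ fun k _ =>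
      (hint _).const_mul _]
    refine Finset.sum_congr rfl fun j _ => ?_
    rw [integral_finsetSum _ fun k _ => (hint _).const_mul _]
    exact Finset.sum_congr rfl fun k _ => (integral_const_mul _ _).symm
  rw [h]
  exact integral_nonneg_of_ae (hF.mono fun x hx => hx n t c)

theorem charFun (μ : Measure ℝ) [IsFiniteMeasure μ] : IsComplexPosDef (charFun μ) := by
  have hF (x : ℝ) : IsComplexPosDef (fun t => Complex.exp (t * x * Complex.I)) := by
    simpa only [mul_one] using one.exp_mul x
  have hint (t : ℝ) : Integrable (fun x : ℝ => Complex.exp (t * x * Complex.I)) μ := by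
    refine Integrable.of_bound (by fun_prop) 1 (.of_forall fun x => ?_)
    rw [← Complex.ofReal_mul, Complex.norm_exp_ofReal_mul_I]
  have h := integral (μ := μ) (F := fun x t => Complex.exp (t * x * Complex.I))
    (.of_forall hF) hint
  simpa only [← charFun_apply_real] using h

theorem exp_neg_mul_sq {s : ℝ} (hs : 0 ≤ s) :
    IsComplexPosDef (fun t => (Real.exp (-(s * t ^ 2)) : ℂ)) := by
  convert charFun (ProbabilityTheory.gaussianReal 0 (2 * s).toNNReal) using 2 with t
  rw [ProbabilityTheory.charFun_gaussianReal]
  rw [Real.coe_toNNReal _ (by positivity)]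
  push_cast
  ring_nf

/-- The Gamma integral exhibits `(1 + t²)⁻ᵃ` as a mixture of Gaussians. -/
theorem one_add_sq_rpow_neg {a : ℝ} (ha : 0 < a) :
    IsComplexPosDef (fun t => (((1 + t ^ 2) ^ (-a) : ℝ) : ℂ)) := by
  have hpos (t : ℝ) : 0 < 1 + t ^ 2 := by positivity
  have hint (t : ℝ) :
      IntegrableOn (fun s => s ^ (a - 1) * Real.exp (-((1 + t ^ 2) * s))) (Set.Ioi 0) := by
    have := integrableOn_rpow_mul_exp_neg_mul_rpow (p := 1) (s := a - 1) (b := 1 + t ^ 2)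
      (by linarith) one_pos (hpos t)
    simpa only [Real.rpow_one, neg_mul] using this
  have hpd := integral (μ := volume.restrict (Set.Ioi (0 : ℝ)))
    (F := fun s t => ((s ^ (a - 1) * Real.exp (-((1 + t ^ 2) * s)) : ℝ) : ℂ))
    (by
      filter_upwards [ae_restrict_mem measurableSet_Ioi] with s hs
      have hs' : 0 ≤ s := le_of_lt hs
      have h0 : (0 : ℂ) ≤ ((s ^ (a - 1) * Real.exp (-s) : ℝ) : ℂ) := by
        rw [Complex.zero_le_real]
        positivity
      convert (exp_neg_mul_sq hs').const_mul h0 using 2 with t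
      rw [← Complex.ofReal_mul, mul_assoc, ← Real.exp_add]
      ring_nf)
    (fun t => (hint t).ofReal)
  have hΓ : (0 : ℂ) ≤ (((Real.Gamma a)⁻¹ : ℝ) : ℂ) := by
    rw [Complex.zero_le_real]
    exact inv_nonneg.2 (Real.Gamma_pos_of_pos ha).le
  convert hpd.const_mul hΓ using 2 with t
  rw [integral_complex_ofReal, ← Complex.ofReal_mul,
    Real.integral_rpow_mul_exp_neg_mul_Ioi ha (hpos t), one_div, Real.inv_rpow (hpos t).le,
    Real.rpow_neg (hpos t).le]
  field_simp [(Real.Gamma_pos_of_pos ha).ne']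

theorem covB {α : ℝ} (hα : 0 < α) (κ : ℝ) : IsComplexPosDef (fun t => (covB α κ t : ℂ)) := by
  convert (one_add_sq_rpow_neg (half_pos hα)).cos_mul κ using 2 with t
  rw [← Complex.ofReal_mul, Real.rpow_neg (by positivity), ← div_eq_mul_inv, _root_.covB]

end IsComplexPosDef


/-- For every `α > 0`, `ϰ ≥ 0`, the function `B_{α,ϰ}(t) = cos(ϰt)/(1+t²)^{α/2}` is positive
definite on `ℝ`; consequently any convex combination
`B(t) = Σ_{j=0}^κ D_j cos(ϰ_j t)/(1+t²)^{α_j/2}` with `D_j ≥ 0`, `Σ_j D_j = 1`, `α_j > 0`,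
`ϰ_j ≥ 0` is positive definite with `B(0) = 1`, i.e. it is a valid covariance function of a
stationary process with unit variance. -/
theorem covB_posDef_and_mixture (α κ : ℝ) (hα : 0 < α) (hκ : 0 ≤ κ) :
    IsPosDefFn (covB α κ) ∧
    ∀ (K : ℕ) (D αv κv : Fin (K + 1) → ℝ),
      (∀ j, 0 ≤ D j) → (∑ j, D j = 1) → (∀ j, 0 < αv j) → (∀ j, 0 ≤ κv j) →
      IsPosDefFn (fun t => ∑ j, D j * covB (αv j) (κv j) t) ∧
      (∑ j, D j * covB (αv j) (κv j) 0) = 1 := by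
  refine ⟨(isPosDefFn_iff_isComplexPosDef _).2 (IsComplexPosDef.covB hα κ), ?_⟩
  intro K D αv κv hD hsum hαv _
  refine ⟨(isPosDefFn_iff_isComplexPosDef _).2 ?_, by simpa [covB] using hsum⟩
  push_cast
  exact IsComplexPosDef.sum _ fun j _ =>
    (IsComplexPosDef.covB (hαv j) (κv j)).const_mul (Complex.zero_le_real.2 (hD j))
end

section
/- (Theorem 1, consistency of the Walker LSE.) Under conditions A1 and A2, the least-squares estimator in the Walker sense θ̂_T = (Â_{1T}, B̂_{1T}, φ̂_{1T}, …, Â_{NT}, B̂_{NT}, φ̂_{NT}) of the unknown parameter θ = (A_1, B_1, φ_1, …, A_N, B_N, φ_N) of the trigonometric regression function is weakly consistent as T → ∞: for each k = 1, …, N, Â_{kT} → A_k in probability, B̂_{kT} → B_k in probability, and T(φ̂_{kT} − φ_k) → 0 in probability. -/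
open MeasureTheory Real Filter Topology ProbabilityTheory

/-- The Fourier transform of the uniform distribution on `[0, 1]`. -/
noncomputable def unitKernel (x : ℝ) : ℂ := ∫ t in (0 : ℝ)..1, Complex.exp (x * t * Complex.I)

lemma unitKernel_eq (x : ℝ) :
    unitKernel x = Complex.exp (x / 2 * Complex.I) * (Real.sinc (x / 2) : ℂ) := by
  rcases eq_or_ne x 0 with rfl | hx
  · simp [unitKernel]
  have hx' : (x : ℂ) ≠ 0 := by exact_mod_cast hx
  have hxI : (x : ℂ) * Complex.I ≠ 0 := mul_ne_zero hx' Complex.I_ne_zero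
  have h1 : unitKernel x = (Complex.exp (x * Complex.I) - 1) / (x * Complex.I) := by
    have := integral_exp_mul_complex (a := 0) (b := 1) hxI
    simp only [Complex.ofReal_one, Complex.ofReal_zero, mul_one, mul_zero, Complex.exp_zero] at this
    rw [← this, unitKernel]
    congr 1; ext t; congr 1; ring
  have h2 : Complex.exp (x * Complex.I) =
      Complex.exp (x / 2 * Complex.I) * Complex.exp (x / 2 * Complex.I) := by
    rw [← Complex.exp_add]; congr 1; ring
  have h3 : Complex.exp (x / 2 * Complex.I) * Complex.exp (-(x / 2) * Complex.I) = 1 := by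
    rw [← Complex.exp_add]; simp
  rw [h1, Real.sinc_of_ne_zero (by positivity)]
  push_cast
  rw [Complex.sin, h2]
  generalize Complex.exp (x / 2 * Complex.I) = E at *
  generalize Complex.exp (-(x / 2) * Complex.I) = E' at *
  field_simp
  linear_combination h3 - (E * E' - E ^ 2) * Complex.I_sq

lemma norm_unitKernel (x : ℝ) : ‖unitKernel x‖ = |Real.sinc (x / 2)| := by
  have : ‖Complex.exp (x / 2 * Complex.I)‖ = 1 := by
    have := Complex.norm_exp_ofReal_mul_I (x / 2)
    push_cast at this; exact this
  rw [unitKernel_eq, norm_mul, this, one_mul, Complex.norm_real, Real.norm_eq_abs]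

lemma norm_unitKernel_le_one (x : ℝ) : ‖unitKernel x‖ ≤ 1 := by
  rw [norm_unitKernel]; exact Real.abs_sinc_le_one _

@[simp] lemma unitKernel_zero : unitKernel 0 = 1 := by simp [unitKernel]

lemma unitKernel_mul_unitKernel_neg (x : ℝ) :
    unitKernel x * unitKernel (-x) = ((‖unitKernel x‖ ^ 2 : ℝ) : ℂ) := by
  have h3 : Complex.exp (x / 2 * Complex.I) * Complex.exp (-(x / 2) * Complex.I) = 1 := by
    rw [← Complex.exp_add]; simp
  rw [norm_unitKernel, unitKernel_eq, unitKernel_eq, neg_div, Real.sinc_neg, sq_abs]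
  push_cast
  rw [neg_div]
  linear_combination (Real.sinc (x / 2) : ℂ) ^ 2 * h3

lemma norm_unitKernel_le_div {x : ℝ} (hx : x ≠ 0) : ‖unitKernel x‖ ≤ 2 / |x| := by
  rw [norm_unitKernel, Real.sinc_of_ne_zero (by positivity), abs_div, abs_div, abs_two]
  have : 0 < |x| := abs_pos.2 hx
  rw [div_div_eq_mul_div]
  gcongr
  linarith [Real.abs_sin_le_one (x / 2)]

lemma continuous_unitKernel : Continuous unitKernel := by
  have : unitKernel = fun x : ℝ => Complex.exp (x / 2 * Complex.I) * (Real.sinc (x / 2) : ℂ) :=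
    funext unitKernel_eq
  rw [this]
  have := Real.continuous_sinc
  fun_prop

lemma tendsto_unitKernel_of_abs {ι : Type*} {l : Filter ι} {x : ι → ℝ}
    (hx : Tendsto (fun i => |x i|) l atTop) : Tendsto (fun i => unitKernel (x i)) l (𝓝 0) := by
  rw [tendsto_zero_iff_norm_tendsto_zero]
  refine squeeze_zero' (Eventually.of_forall fun _ => norm_nonneg _) ?_
    (Tendsto.const_div_atTop hx 2)
  filter_upwards [hx.eventually_gt_atTop 0] with i hi
  exact norm_unitKernel_le_div (abs_pos.1 hi)

lemma norm_unitKernel_lt_one {x : ℝ} (hx : x ≠ 0) : ‖unitKernel x‖ < 1 := by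
  rw [norm_unitKernel, Real.sinc_of_ne_zero (by positivity), abs_div, div_lt_one (by positivity)]
  exact Real.abs_sin_lt_abs (by positivity)

lemma tendsto_zero_of_norm_unitKernel_tendsto_one {ι : Type*} {l : Filter ι} {x : ι → ℝ}
    (hx : Tendsto (fun i => ‖unitKernel (x i)‖) l (𝓝 1)) : Tendsto x l (𝓝 0) := by
  rw [Metric.tendsto_nhds]
  intro ε hε
  obtain ⟨ρ, hρ, hρx⟩ : ∃ ρ < 1, ∀ y : ℝ, ε ≤ |y| → ‖unitKernel y‖ ≤ ρ := by
    have hc : IsCompact (Metric.closedBall (0 : ℝ) 4 ∩ {y | ε ≤ |y|}) :=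
      (isCompact_closedBall 0 4).inter_right (isClosed_le continuous_const continuous_abs)
    have hfar : ∀ y : ℝ, 4 < |y| → ‖unitKernel y‖ ≤ 1 / 2 := by
      intro y hy
      refine (norm_unitKernel_le_div (abs_pos.1 (by linarith))).trans ?_
      rw [div_le_iff₀ (by linarith)]; linarith
    rcases (Metric.closedBall (0 : ℝ) 4 ∩ {y | ε ≤ |y|}).eq_empty_or_nonempty with he | hne
    · refine ⟨1 / 2, by norm_num, fun y hy => hfar y ?_⟩
      by_contra! h
      have : y ∈ Metric.closedBall (0 : ℝ) 4 ∩ {y | ε ≤ |y|} := ⟨by simpa using h, hy⟩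
      simp [he] at this
    · obtain ⟨z, hz, hmax⟩ := hc.exists_isMaxOn hne continuous_unitKernel.norm.continuousOn
      have hz0 : z ≠ 0 := abs_pos.1 (hε.trans_le hz.2)
      refine ⟨max (1 / 2) ‖unitKernel z‖, max_lt (by norm_num) (norm_unitKernel_lt_one hz0),
        fun y hy => ?_⟩
      rcases le_or_gt |y| 4 with h | h
      · exact le_max_of_le_right (hmax ⟨by simpa using h, hy⟩)
      · exact le_max_of_le_left (hfar y h)
  filter_upwards [hx.eventually_const_lt hρ] with i hi
  rw [Real.dist_eq, sub_zero]
  by_contra! h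
  exact absurd (hρx _ h) (not_le.2 hi)

lemma sum_norm_isBounded_of_exponential_sums_close {N : ℕ} {ι : Type*} {l : Filter ι}
    (c : Fin N → ℂ) (ν ν' : ι → Fin N → ℝ) (c' : ι → Fin N → ℂ)
    (hν' : ∀ j k, j ≠ k → Tendsto (fun i => |ν' i j - ν' i k|) l atTop)
    (ρ : ι → ℝ) (hρ : Tendsto ρ l (𝓝 0)) (C : ℝ)
    (H : ∀ᶠ i in l, ∀ x, ‖∑ j, c j * unitKernel (ν i j - x) - ∑ j, c' i j * unitKernel (ν' i j - x)‖
      ≤ ρ i * (∑ j, ‖c' i j‖ + C)) :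
    ∃ M, ∀ᶠ i in l, ∑ j, ‖c' i j‖ ≤ M := by
  set η : ι → ℝ := fun i => ∑ k, ∑ j ∈ Finset.univ.erase k, ‖unitKernel (ν' i j - ν' i k)‖ with hη
  have hη0 : Tendsto η l (𝓝 0) := by
    have : Tendsto η l (𝓝 (∑ k : Fin N, ∑ j ∈ Finset.univ.erase k, (0 : ℝ))) := by
      refine tendsto_finsetSum _ fun k _ => tendsto_finsetSum _ fun j hj => ?_
      have := (tendsto_unitKernel_of_abs (hν' j k (Finset.ne_of_mem_erase hj))).norm
      simpa using this
    simpa using this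
  have h1 : Tendsto (fun i => η i + N * ρ i) l (𝓝 0) := by
    simpa using hη0.add (hρ.const_mul (N : ℝ))
  have h2 : Tendsto (fun i => N * (ρ i * C)) l (𝓝 0) := by
    simpa using (hρ.mul_const C).const_mul (N : ℝ)
  refine ⟨2 * (N * ∑ j, ‖c j‖ + 1), ?_⟩
  filter_upwards [H, h1.eventually_le_const (show (0 : ℝ) < 1 / 2 by norm_num),
    h2.eventually_le_const one_pos] with i hi h1i h2i
  set S := ∑ j, ‖c' i j‖ with hS
  have hS0 : 0 ≤ S := Finset.sum_nonneg fun _ _ => norm_nonneg _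
  have key : ∀ k, ‖c' i k‖ ≤ ∑ j, ‖c j‖ +
      (∑ j ∈ Finset.univ.erase k, ‖unitKernel (ν' i j - ν' i k)‖) * S + ρ i * (S + C) := by
    intro k
    have hk := hi (ν' i k)
    rw [← Finset.add_sum_erase Finset.univ (fun j => c' i j * unitKernel (ν' i j - ν' i k))
      (Finset.mem_univ k)] at hk
    simp only [sub_self, unitKernel_zero, mul_one] at hk
    have e1 : ‖∑ j, c j * unitKernel (ν i j - ν' i k)‖ ≤ ∑ j, ‖c j‖ := by
      refine norm_sum_le_of_le _ fun j _ => ?_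
      rw [norm_mul]
      exact mul_le_of_le_one_right (norm_nonneg _) (norm_unitKernel_le_one _)
    have e2 : ‖∑ j ∈ Finset.univ.erase k, c' i j * unitKernel (ν' i j - ν' i k)‖ ≤
        (∑ j ∈ Finset.univ.erase k, ‖unitKernel (ν' i j - ν' i k)‖) * S := by
      rw [Finset.sum_mul]
      refine norm_sum_le_of_le _ fun j _ => ?_
      rw [norm_mul, mul_comm]
      gcongr
      exact Finset.single_le_sum (f := fun j => ‖c' i j‖) (fun _ _ => norm_nonneg _)
        (Finset.mem_univ j)
    set X := ∑ j, c j * unitKernel (ν i j - ν' i k)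
    set Y := ∑ j ∈ Finset.univ.erase k, c' i j * unitKernel (ν' i j - ν' i k)
    have : c' i k = X - Y - (X - (c' i k + Y)) := by ring
    calc ‖c' i k‖ = ‖X - Y - (X - (c' i k + Y))‖ := by rw [← this]
      _ ≤ ‖X‖ + ‖Y‖ + ‖X - (c' i k + Y)‖ :=
        (norm_sub_le _ _).trans (add_le_add_left (norm_sub_le _ _) _)
      _ ≤ _ := by linarith
  have hsum : S ≤ N * ∑ j, ‖c j‖ + (η i + N * ρ i) * S + N * (ρ i * C) := by
    calc S ≤ ∑ k : Fin N, (∑ j, ‖c j‖ +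
        (∑ j ∈ Finset.univ.erase k, ‖unitKernel (ν' i j - ν' i k)‖) * S + ρ i * (S + C)) :=
          Finset.sum_le_sum fun k _ => key k
      _ = _ := by
        rw [Finset.sum_add_distrib, Finset.sum_add_distrib, ← Finset.sum_mul]
        simp only [Finset.sum_const, Finset.card_univ, Fintype.card_fin, nsmul_eq_mul, hη]
        ring
  nlinarith

lemma tendsto_of_exponential_sums_close {N : ℕ} {ι : Type*} {l : Filter ι}
    (c : Fin N → ℂ) (hc : ∀ k, c k ≠ 0) (ν ν' : ι → Fin N → ℝ) (c' : ι → Fin N → ℂ)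
    (hν : ∀ j k, j < k → Tendsto (fun i => ν i k - ν i j) l atTop)
    (hν' : ∀ j k, j < k → Tendsto (fun i => ν' i k - ν' i j) l atTop)
    (ρ : ι → ℝ) (hρ : Tendsto ρ l (𝓝 0)) (C : ℝ)
    (H : ∀ᶠ i in l, ∀ x, ‖∑ j, c j * unitKernel (ν i j - x) - ∑ j, c' i j * unitKernel (ν' i j - x)‖
      ≤ ρ i * (∑ j, ‖c' i j‖ + C)) (k : Fin N) :
    Tendsto (fun i => c' i k) l (𝓝 (c k)) ∧ Tendsto (fun i => ν' i k - ν i k) l (𝓝 0) := by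
  have habs : ∀ w : ι → Fin N → ℝ, (∀ j k, j < k → Tendsto (fun i => w i k - w i j) l atTop) →
      ∀ j k, j ≠ k → Tendsto (fun i => |w i j - w i k|) l atTop := by
    intro w hw j k hjk
    rcases lt_or_gt_of_ne hjk with h | h
    · refine (tendsto_abs_atTop_atTop.comp (hw j k h)).congr fun i => ?_
      exact abs_sub_comm _ _
    · exact tendsto_abs_atTop_atTop.comp (hw k j h)
  have hνa := habs ν hν
  have hνa' := habs ν' hν'
  obtain ⟨M, hM⟩ := sum_norm_isBounded_of_exponential_sums_close c ν ν' c' hνa' ρ hρ C H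
  have hM1 : ∀ᶠ i in l, ∀ j, ‖c' i j‖ ≤ M := by
    filter_upwards [hM] with i hi j
    exact (Finset.single_le_sum (f := fun j => ‖c' i j‖) (fun _ _ => norm_nonneg _)
        (Finset.mem_univ j)).trans hi
  have hbdd : ∀ j (z : ι → ℂ), Tendsto z l (𝓝 0) → Tendsto (fun i => c' i j * z i) l (𝓝 0) := by
    intro j z hz
    rw [tendsto_zero_iff_norm_tendsto_zero] at hz ⊢
    refine squeeze_zero' (Eventually.of_forall fun _ => norm_nonneg _) ?_
      (by simpa using hz.const_mul M)
    filter_upwards [hM1] with i hi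
    rw [norm_mul]
    exact mul_le_mul_of_nonneg_right (hi j) (norm_nonneg _)
  have herr : ∀ x : ι → ℝ, Tendsto (fun i => ∑ j, c j * unitKernel (ν i j - x i) -
      ∑ j, c' i j * unitKernel (ν' i j - x i)) l (𝓝 0) := by
    intro x
    have hr : Tendsto (fun i => |ρ i| * (M + |C|)) l (𝓝 0) := by
      simpa using hρ.abs.mul_const (M + |C|)
    refine squeeze_zero_norm' ?_ hr
    filter_upwards [H, hM] with i hi hMi
    refine (hi (x i)).trans ((le_abs_self _).trans ?_)
    rw [abs_mul]
    gcongr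
    refine (abs_add_le _ _).trans ?_
    gcongr
    rwa [abs_of_nonneg (Finset.sum_nonneg fun _ _ => norm_nonneg _)]
  have hself : ∀ k, Tendsto (fun i => ∑ j, c j * unitKernel (ν i j - ν i k)) l (𝓝 (c k)) := by
    intro k
    have h0 : Tendsto (fun i => ∑ j ∈ Finset.univ.erase k, c j * unitKernel (ν i j - ν i k)) l
        (𝓝 (∑ j ∈ Finset.univ.erase k, (0 : ℂ))) := by
      refine tendsto_finsetSum _ fun j hj => ?_
      simpa using (tendsto_unitKernel_of_abs (hνa j k (Finset.ne_of_mem_erase hj))).const_mul (c j)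
    have := h0.const_add (c k)
    simp only [Finset.sum_const_zero, add_zero] at this
    refine this.congr fun i => ?_
    rw [← Finset.add_sum_erase Finset.univ (fun j => c j * unitKernel (ν i j - ν i k))
      (Finset.mem_univ k)]
    simp
  have hother : ∀ k, Tendsto (fun i => ∑ j, c' i j * unitKernel (ν' i j - ν i k)) l
      (𝓝 (c k)) := by
    intro k
    have := (hself k).sub (herr fun i => ν i k)
    simpa using this
  -- each true frequency has an estimated frequency at bounded distance
  obtain ⟨R, hR0, hR⟩ : ∃ R > 0, ∀ k, M * (2 / R) < ‖c k‖ := by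
    have : ∀ᶠ R : ℝ in atTop, ∀ k, M * (2 / R) < ‖c k‖ := by
      rw [eventually_all]
      intro k
      have : Tendsto (fun R : ℝ => M * (2 / R)) atTop (𝓝 (M * 0)) :=
        (tendsto_const_nhds.div_atTop tendsto_id).const_mul M
      rw [mul_zero] at this
      exact this.eventually_lt_const (norm_pos_iff.2 (hc k))
    obtain ⟨R, h1, h2⟩ := ((eventually_gt_atTop (0 : ℝ)).and this).exists
    exact ⟨R, h1, h2⟩
  have hmatch : ∀ᶠ i in l, ∀ k, ∃ j, |ν' i j - ν i k| ≤ R := by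
    rw [eventually_all]
    intro k
    filter_upwards [(hother k).norm.eventually_const_lt (hR k), hM] with i hi hMi
    by_contra! hcon
    refine absurd hi (not_lt.2 ?_)
    calc _ ≤ ∑ j, ‖c' i j‖ * (2 / R) := by
          refine norm_sum_le_of_le _ fun j _ => ?_
          rw [norm_mul]
          gcongr
          refine (norm_unitKernel_le_div (abs_pos.1 (hR0.trans (hcon j)))).trans ?_
          gcongr
          exact (hcon j).le
      _ ≤ M * (2 / R) := by rw [← Finset.sum_mul]; gcongr
  have hclose : ∀ᶠ i in l, ∀ k, |ν' i k - ν i k| ≤ R := by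
    have hs : ∀ᶠ i in l, ∀ j k, j < k → 2 * R < ν i k - ν i j := by
      simp only [eventually_all]
      exact fun j k h => (hν j k h).eventually_gt_atTop _
    have hs' : ∀ᶠ i in l, ∀ j k, j < k → 0 < ν' i k - ν' i j := by
      simp only [eventually_all]
      exact fun j k h => (hν' j k h).eventually_gt_atTop _
    filter_upwards [hmatch, hs, hs'] with i hi hsi hsi' k
    choose σ hσ using hi
    have hmono' : StrictMono (ν' i) := fun a b h => by linarith [hsi' a b h]
    have hmono : StrictMono σ := by
      intro a b h
      rw [← hmono'.lt_iff_lt]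
      have h1 := abs_le.1 (hσ a)
      have h2 := abs_le.1 (hσ b)
      linarith [hsi a b h, h1.2, h2.1]
    have hid : σ = id := (StrictMono.range_inj hmono strictMono_id).1
      (by simp [(Finite.injective_iff_surjective.1 hmono.injective).range_eq])
    simpa [hid] using hσ k
  have hfar : ∀ j k, j ≠ k → Tendsto (fun i => |ν' i j - ν i k|) l atTop := by
    intro j k hjk
    refine tendsto_atTop_mono' l ?_ (tendsto_atTop_add_const_right l (-R) (hνa j k hjk))
    filter_upwards [hclose] with i hi
    have h1 := hi j
    have : |ν i j - ν i k| ≤ |ν' i j - ν i k| + |ν' i j - ν i j| := by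
      have := abs_sub (ν' i j - ν i k) (ν' i j - ν i j)
      rwa [show ν' i j - ν i k - (ν' i j - ν i j) = ν i j - ν i k by ring] at this
    linarith
  have hE1 : Tendsto (fun i => c' i k * unitKernel (ν' i k - ν i k)) l (𝓝 (c k)) := by
    have h0 : Tendsto (fun i => ∑ j ∈ Finset.univ.erase k, c' i j * unitKernel (ν' i j - ν i k)) l
        (𝓝 (∑ j ∈ Finset.univ.erase k, (0 : ℂ))) := by
      refine tendsto_finsetSum _ fun j hj => ?_
      exact hbdd j _ (tendsto_unitKernel_of_abs (hfar j k (Finset.ne_of_mem_erase hj)))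
    have := (hother k).sub h0
    simp only [Finset.sum_const_zero, sub_zero] at this
    refine this.congr fun i => ?_
    rw [← Finset.add_sum_erase Finset.univ (fun j => c' i j * unitKernel (ν' i j - ν i k))
      (Finset.mem_univ k)]
    ring
  have hE2 : Tendsto (fun i => c k * unitKernel (-(ν' i k - ν i k)) - c' i k) l (𝓝 0) := by
    have h0 : Tendsto (fun i => ∑ j ∈ Finset.univ.erase k, c j * unitKernel (ν i j - ν' i k)) l
        (𝓝 (∑ j ∈ Finset.univ.erase k, (0 : ℂ))) := by
      refine tendsto_finsetSum _ fun j hj => ?_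
      have := tendsto_unitKernel_of_abs ((hfar k j (Finset.ne_of_mem_erase hj).symm).congr
        fun i => abs_sub_comm _ _)
      simpa using this.const_mul (c j)
    have h0' : Tendsto (fun i => ∑ j ∈ Finset.univ.erase k, c' i j * unitKernel (ν' i j - ν' i k)) l
        (𝓝 (∑ j ∈ Finset.univ.erase k, (0 : ℂ))) := by
      refine tendsto_finsetSum _ fun j hj => ?_
      exact hbdd j _ (tendsto_unitKernel_of_abs (hνa' j k (Finset.ne_of_mem_erase hj)))
    have := ((herr fun i => ν' i k).sub h0).add h0'
    simp only [Finset.sum_const_zero, sub_zero, add_zero] at this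
    refine this.congr fun i => ?_
    rw [← Finset.add_sum_erase Finset.univ (fun j => c' i j * unitKernel (ν' i j - ν' i k))
      (Finset.mem_univ k), ← Finset.add_sum_erase Finset.univ
      (fun j => c j * unitKernel (ν i j - ν' i k)) (Finset.mem_univ k)]
    simp only [sub_self, unitKernel_zero, mul_one, neg_sub]
    ring
  have hsq : Tendsto (fun i => ‖unitKernel (ν' i k - ν i k)‖ ^ 2) l (𝓝 1) := by
    have hb : Tendsto (fun i => unitKernel (ν' i k - ν i k) *
        (c k * unitKernel (-(ν' i k - ν i k)) - c' i k)) l (𝓝 0) := by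
      rw [tendsto_zero_iff_norm_tendsto_zero] at hE2 ⊢
      refine squeeze_zero (fun _ => norm_nonneg _) (fun i => ?_) hE2
      rw [norm_mul]
      exact mul_le_of_le_one_left (norm_nonneg _) (norm_unitKernel_le_one _)
    have h1 := (hb.add hE1).const_mul (c k)⁻¹
    rw [zero_add, inv_mul_cancel₀ (hc k)] at h1
    have h2 := h1.congr (f₂ := fun i => ((‖unitKernel (ν' i k - ν i k)‖ ^ 2 : ℝ) : ℂ)) fun i => by
      rw [← unitKernel_mul_unitKernel_neg]
      field_simp [hc k]
      ring
    have h3 := (Complex.continuous_re.tendsto 1).comp h2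
    simpa [Function.comp_def, ← Complex.ofReal_pow] using h3
  have hd : Tendsto (fun i => ν' i k - ν i k) l (𝓝 0) := by
    refine tendsto_zero_of_norm_unitKernel_tendsto_one ?_
    have := hsq.sqrt
    simpa [Real.sqrt_sq] using this
  refine ⟨?_, hd⟩
  have hK : Tendsto (fun i => unitKernel (-(ν' i k - ν i k))) l (𝓝 1) := by
    have := (continuous_unitKernel.tendsto 0).comp (by simpa using hd.neg)
    simpa [Function.comp_def] using this
  have := (hK.const_mul (c k)).sub hE2
  simpa using this

lemma sq_intervalIntegral_le_of_continuous {f : ℝ → ℝ} (hf : Continuous f) :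
    (∫ t in (0 : ℝ)..1, f t) ^ 2 ≤ ∫ t in (0 : ℝ)..1, f t ^ 2 := by
  set m := ∫ t in (0 : ℝ)..1, f t with hm
  have h0 : 0 ≤ ∫ t in (0 : ℝ)..1, (f t - m) ^ 2 :=
    intervalIntegral.integral_nonneg zero_le_one fun t _ => sq_nonneg _
  have h1 : ∫ t in (0 : ℝ)..1, (f t - m) ^ 2 = (∫ t in (0 : ℝ)..1, f t ^ 2) - 2 * m * m + m ^ 2 := by
    have : ∀ t, (f t - m) ^ 2 = f t ^ 2 - 2 * m * f t + m ^ 2 := fun t => by ring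
    simp only [this]
    rw [intervalIntegral.integral_add (Continuous.intervalIntegrable (by fun_prop) _ _)
      (Continuous.intervalIntegrable (by fun_prop) _ _), intervalIntegral.integral_sub
      (Continuous.intervalIntegrable (by fun_prop) _ _)
      (Continuous.intervalIntegrable (by fun_prop) _ _), intervalIntegral.integral_const_mul]
    simp [← hm]
  nlinarith

lemma norm_sum_unitKernel_sq_le {J : Type*} [Fintype J] (C : J → ℂ) (w : J → ℝ) (X : ℝ → ℝ)
    (hX : IntervalIntegrable X volume 0 1) (hX2 : IntervalIntegrable (fun t => X t ^ 2) volume 0 1)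
    (δ : ℝ) (hδ : ∀ x : ℝ, ‖∫ t in (0 : ℝ)..1, (X t : ℂ) * Complex.exp (x * t * Complex.I)‖ ≤ δ)
    (hle : ∫ t in (0 : ℝ)..1, ((∑ j, C j * Complex.exp (w j * t * Complex.I)).re + X t) ^ 2 ≤
      ∫ t in (0 : ℝ)..1, X t ^ 2) (x : ℝ) :
    ‖∑ j, C j * unitKernel (w j - x)‖ ^ 2 ≤
      4 * δ * (∑ j, ‖C j‖) + (∑ j, ∑ k, ‖unitKernel (w j + w k)‖) * (∑ j, ‖C j‖) ^ 2 := by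
  set S := ∑ j, ‖C j‖ with hS
  set H : ℝ → ℂ := fun t => ∑ j, C j * Complex.exp (w j * t * Complex.I) with hH
  have hHc : Continuous H := by fun_prop
  have hhc : Continuous fun t => (H t).re := Complex.continuous_re.comp hHc
  have hle' : ∀ j, ‖C j‖ ≤ S := fun j =>
    Finset.single_le_sum (f := fun j => ‖C j‖) (fun _ _ => norm_nonneg _) (Finset.mem_univ j)
  have hXC : IntervalIntegrable (fun t => (X t : ℂ)) volume 0 1 := ⟨hX.1.ofReal, hX.2.ofReal⟩
  have hXe : ∀ y : ℝ, IntervalIntegrable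
      (fun t : ℝ => (X t : ℂ) * Complex.exp (y * t * Complex.I)) volume 0 1 := fun y =>
    hXC.mul_continuousOn (Continuous.continuousOn (by fun_prop))
  have hXh : IntervalIntegrable (fun t => (H t).re * X t) volume 0 1 :=
    hX.continuousOn_mul hhc.continuousOn
  have hcross : |∫ t in (0 : ℝ)..1, (H t).re * X t| ≤ δ * S := by
    have e1 : ∫ t in (0 : ℝ)..1, H t * X t =
        ∑ j, C j * ∫ t in (0 : ℝ)..1, (X t : ℂ) * Complex.exp (w j * t * Complex.I) := by
      simp_rw [← intervalIntegral.integral_const_mul]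
      rw [← intervalIntegral.integral_finsetSum fun j _ => (hXe (w j)).const_mul (C j)]
      refine intervalIntegral.integral_congr fun t _ => ?_
      simp only [hH, Finset.sum_mul]
      exact Finset.sum_congr rfl fun j _ => by ring
    have e2 : ∫ t in (0 : ℝ)..1, (H t).re * X t = (∫ t in (0 : ℝ)..1, H t * X t).re := by
      have : IntervalIntegrable (fun t => H t * (X t : ℂ)) volume 0 1 :=
        hXC.continuousOn_mul hHc.continuousOn
      have h := Complex.reCLM.intervalIntegral_comp_comm this
      simp only [Complex.reCLM_apply, Complex.re_mul_ofReal] at h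
      exact h
    rw [e2, e1]
    refine (Complex.abs_re_le_norm _).trans ?_
    rw [hS, Finset.mul_sum]
    refine norm_sum_le_of_le _ fun j _ => ?_
    rw [norm_mul, mul_comm]
    exact mul_le_mul_of_nonneg_right (hδ _) (norm_nonneg _)
  have hh2 : ∫ t in (0 : ℝ)..1, (H t).re ^ 2 ≤ 2 * (δ * S) := by
    have e : ∫ t in (0 : ℝ)..1, ((H t).re + X t) ^ 2 = (∫ t in (0 : ℝ)..1, (H t).re ^ 2) +
        2 * (∫ t in (0 : ℝ)..1, (H t).re * X t) + ∫ t in (0 : ℝ)..1, X t ^ 2 := by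
      have : ∀ t, ((H t).re + X t) ^ 2 = (H t).re ^ 2 + 2 * ((H t).re * X t) + X t ^ 2 :=
        fun t => by ring
      simp only [this]
      have hi : IntervalIntegrable (fun t => (H t).re ^ 2) volume 0 1 :=
        (hhc.pow 2).intervalIntegrable _ _
      rw [intervalIntegral.integral_add (hi.add (hXh.const_mul 2)) hX2,
        intervalIntegral.integral_add hi (hXh.const_mul 2), intervalIntegral.integral_const_mul]
    have := (abs_le.1 hcross).1
    linarith
  have hHH : ‖∫ t in (0 : ℝ)..1, H t ^ 2‖ ≤ (∑ j, ∑ k, ‖unitKernel (w j + w k)‖) * S ^ 2 := by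
    have e1 : ∫ t in (0 : ℝ)..1, H t ^ 2 =
        ∑ j, ∑ k, C j * C k * unitKernel (w j + w k) := by
      simp_rw [unitKernel, ← intervalIntegral.integral_const_mul]
      have hin : ∀ j, ∑ k, ∫ t in (0 : ℝ)..1, C j * C k *
          Complex.exp (((w j + w k : ℝ) : ℂ) * t * Complex.I) = ∫ t in (0 : ℝ)..1, ∑ k, C j * C k *
          Complex.exp (((w j + w k : ℝ) : ℂ) * t * Complex.I) := fun j =>
        (intervalIntegral.integral_finsetSum
          fun k _ => Continuous.intervalIntegrable (by fun_prop) _ _).symm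
      simp_rw [hin]
      rw [← intervalIntegral.integral_finsetSum
        (fun k _ => Continuous.intervalIntegrable (by fun_prop) _ _)]
      refine intervalIntegral.integral_congr fun t _ => ?_
      simp only [hH, sq, Finset.sum_mul_sum]
      refine Finset.sum_congr rfl fun j _ => Finset.sum_congr rfl fun k _ => ?_
      rw [show ((w j + w k : ℝ) : ℂ) * t * Complex.I = w j * t * Complex.I + w k * t * Complex.I by
        push_cast; ring, Complex.exp_add]
      ring
    rw [e1, Finset.sum_mul]
    refine norm_sum_le_of_le _ fun j _ => ?_
    rw [Finset.sum_mul]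
    refine norm_sum_le_of_le _ fun k _ => ?_
    rw [norm_mul, norm_mul, mul_comm, sq]
    gcongr
    · exact hle' j
    · exact hle' k
  have hnorm : ∫ t in (0 : ℝ)..1, ‖H t‖ ^ 2 ≤
      4 * δ * S + (∑ j, ∑ k, ‖unitKernel (w j + w k)‖) * S ^ 2 := by
    have e : ∫ t in (0 : ℝ)..1, ‖H t‖ ^ 2 =
        2 * (∫ t in (0 : ℝ)..1, (H t).re ^ 2) - (∫ t in (0 : ℝ)..1, H t ^ 2).re := by
      have hi : IntervalIntegrable (fun t => H t ^ 2) volume 0 1 :=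
        (hHc.pow 2).intervalIntegrable _ _
      have h := Complex.reCLM.intervalIntegral_comp_comm hi
      simp only [Complex.reCLM_apply] at h
      have hi1 : IntervalIntegrable (fun t => 2 * (H t).re ^ 2) volume 0 1 :=
        ((hhc.pow 2).const_mul 2).intervalIntegrable _ _
      have hi2 : IntervalIntegrable (fun t => (H t ^ 2).re) volume 0 1 :=
        (Complex.continuous_re.comp (hHc.pow 2)).intervalIntegrable _ _
      rw [← h, ← intervalIntegral.integral_const_mul, ← intervalIntegral.integral_sub hi1 hi2]
      refine intervalIntegral.integral_congr fun t _ => ?_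
      simp only [Complex.sq_norm, Complex.normSq_apply]
      simp only [sq, Complex.mul_re]
      ring
    have h1 := (abs_le.1 (Complex.abs_re_le_norm (∫ t in (0 : ℝ)..1, H t ^ 2))).1
    linarith
  have hK : ∑ j, C j * unitKernel (w j - x) =
      ∫ t in (0 : ℝ)..1, H t * Complex.exp (-x * t * Complex.I) := by
    simp_rw [unitKernel, ← intervalIntegral.integral_const_mul]
    rw [← intervalIntegral.integral_finsetSum
      (fun k _ => Continuous.intervalIntegrable (by fun_prop) _ _)]
    refine intervalIntegral.integral_congr fun t _ => ?_
    simp only [hH, Finset.sum_mul]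
    refine Finset.sum_congr rfl fun j _ => ?_
    rw [show ((w j - x : ℝ) : ℂ) * t * Complex.I = w j * t * Complex.I + -x * t * Complex.I by
      push_cast; ring, Complex.exp_add]
    ring
  calc ‖∑ j, C j * unitKernel (w j - x)‖ ^ 2 ≤ (∫ t in (0 : ℝ)..1, ‖H t‖) ^ 2 := by
        rw [hK]
        gcongr
        refine (intervalIntegral.norm_integral_le_integral_norm zero_le_one).trans_eq ?_
        refine intervalIntegral.integral_congr fun t _ => ?_
        have := Complex.norm_exp_ofReal_mul_I (-x * t)
        push_cast at this
        simp only [norm_mul, this, mul_one]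
    _ ≤ ∫ t in (0 : ℝ)..1, ‖H t‖ ^ 2 := sq_intervalIntegral_le_of_continuous hHc.norm
    _ ≤ _ := hnorm

lemma re_sub_mul_I_mul_exp (a b y : ℝ) :
    (((a : ℂ) - b * Complex.I) * Complex.exp (y * Complex.I)).re = a * cos y + b * sin y := by
  simp [Complex.exp_mul_I, Complex.cos_ofReal_re, Complex.sin_ofReal_re]

lemma tendsto_of_least_squares {N : ℕ} {ι : Type*} {l : Filter ι} (A B : Fin N → ℝ)
    (hAB : ∀ k, 0 < A k ^ 2 + B k ^ 2) (ν ν' a b : ι → Fin N → ℝ) (X : ι → ℝ → ℝ)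
    (hν : ∀ j k, j < k → Tendsto (fun i => ν i k - ν i j) l atTop)
    (hν' : ∀ j k, j < k → Tendsto (fun i => ν' i k - ν' i j) l atTop)
    (hν0 : ∀ k, Tendsto (fun i => ν i k) l atTop) (hν0' : ∀ k, Tendsto (fun i => ν' i k) l atTop)
    (hX : ∀ i, IntervalIntegrable (X i) volume 0 1)
    (hX2 : ∀ i, IntervalIntegrable (fun t => X i t ^ 2) volume 0 1)
    (δ : ι → ℝ) (hδ0 : Tendsto δ l (𝓝 0))
    (hδ : ∀ i, ∀ x : ℝ,
      ‖∫ t in (0 : ℝ)..1, (X i t : ℂ) * Complex.exp (x * t * Complex.I)‖ ≤ δ i)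
    (hle : ∀ᶠ i in l, ∫ t in (0 : ℝ)..1, ((∑ k, (A k * cos (ν i k * t) + B k * sin (ν i k * t))) +
      X i t - ∑ k, (a i k * cos (ν' i k * t) + b i k * sin (ν' i k * t))) ^ 2 ≤
      ∫ t in (0 : ℝ)..1, X i t ^ 2) (k : Fin N) :
    Tendsto (fun i => a i k) l (𝓝 (A k)) ∧ Tendsto (fun i => b i k) l (𝓝 (B k)) ∧
      Tendsto (fun i => ν' i k - ν i k) l (𝓝 0) := by
  set c : Fin N → ℂ := fun k => (A k : ℂ) - B k * Complex.I with hc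
  set c' : ι → Fin N → ℂ := fun i k => (a i k : ℂ) - b i k * Complex.I with hc'
  have hc0 : ∀ k, c k ≠ 0 := by
    intro k h
    have h1 := congrArg Complex.re h
    have h2 := congrArg Complex.im h
    simp [hc] at h1 h2
    have := hAB k
    simp [h1, h2] at this
  set C : ι → Fin N ⊕ Fin N → ℂ := fun i => Sum.elim c (fun k => -c' i k) with hC
  set w : ι → Fin N ⊕ Fin N → ℝ := fun i => Sum.elim (ν i) (ν' i) with hw
  set η : ι → ℝ := fun i => ∑ j, ∑ k, ‖unitKernel (w i j + w i k)‖ with hη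
  have hwt : ∀ j, Tendsto (fun i => w i j) l atTop := by
    rintro (j | j)
    · exact hν0 j
    · exact hν0' j
  have hη0 : Tendsto η l (𝓝 0) := by
    have : Tendsto η l (𝓝 (∑ j : Fin N ⊕ Fin N, ∑ k : Fin N ⊕ Fin N, (0 : ℝ))) := by
      refine tendsto_finsetSum _ fun j _ => tendsto_finsetSum _ fun k _ => ?_
      have h1 : Tendsto (fun i => |w i j + w i k|) l atTop :=
        tendsto_abs_atTop_atTop.comp ((hwt j).atTop_add_atTop (hwt k))
      simpa using (tendsto_unitKernel_of_abs h1).norm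
    simpa using this
  set C₀ := ∑ k, ‖c k‖ with hC₀
  have hS : ∀ i, ∑ j, ‖C i j‖ = ∑ k, ‖c' i k‖ + C₀ := by
    intro i
    simp [hC, Fintype.sum_sum_type, add_comm, hC₀]
  set ρ : ι → ℝ := fun i => √(|δ i| + |η i|) with hρ
  have hρ0 : Tendsto ρ l (𝓝 0) := by
    have := (hδ0.abs.add hη0.abs).sqrt
    simpa using this
  have key : ∀ᶠ i in l, ∀ x, ‖∑ j, c j * unitKernel (ν i j - x) -
      ∑ j, c' i j * unitKernel (ν' i j - x)‖ ≤ ρ i * (∑ j, ‖c' i j‖ + (C₀ + 2)) := by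
    filter_upwards [hle] with i hi x
    have h1 := norm_sum_unitKernel_sq_le (C i) (w i) (X i) (hX i) (hX2 i) (δ i) (hδ i) ?_ x
    · rw [hS] at h1
      have h2 : ∑ j, C i j * unitKernel (w i j - x) = ∑ j, c j * unitKernel (ν i j - x) -
          ∑ j, c' i j * unitKernel (ν' i j - x) := by
        simp [hC, hw, Fintype.sum_sum_type, sub_eq_add_neg]
      rw [h2] at h1
      have hT : 0 ≤ ∑ k, ‖c' i k‖ + C₀ := by positivity
      refine (sq_le_sq₀ (norm_nonneg _) (by positivity)).1 ?_
      rw [mul_pow, hρ, Real.sq_sqrt (by positivity)]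
      refine h1.trans ?_
      have := le_abs_self (δ i)
      have := le_abs_self (η i)
      have := abs_nonneg (δ i)
      have := abs_nonneg (η i)
      change _ + η i * _ ≤ _
      set T := ∑ k, ‖c' i k‖ + C₀
      rw [show ∑ j, ‖c' i j‖ + (C₀ + 2) = T + 2 by simp only [T]; ring]
      have h3 : 4 * δ i * T ≤ 4 * |δ i| * T := by gcongr
      have h4 : η i * T ^ 2 ≤ |η i| * T ^ 2 := by gcongr
      nlinarith [mul_nonneg (abs_nonneg (η i)) hT, mul_nonneg (abs_nonneg (δ i)) (sq_nonneg T)]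
    · refine le_trans (le_of_eq ?_) hi
      refine intervalIntegral.integral_congr fun t _ => ?_
      have h3 : (∑ j, C i j * Complex.exp (w i j * t * Complex.I)).re =
          ∑ k, (A k * cos (ν i k * t) + B k * sin (ν i k * t)) -
          ∑ k, (a i k * cos (ν' i k * t) + b i k * sin (ν' i k * t)) := by
        simp only [hC, hw, Fintype.sum_sum_type, Sum.elim_inl, Sum.elim_inr, Complex.add_re,
          Complex.re_sum, neg_mul, Complex.neg_re, Finset.sum_neg_distrib, ← Complex.ofReal_mul,
          hc, hc', re_sub_mul_I_mul_exp]
        ring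
      simp only [h3]
      ring
  obtain ⟨h1, h2⟩ := tendsto_of_exponential_sums_close c hc0 ν ν' c' hν hν' ρ hρ0 _ key k
  refine ⟨?_, ?_, h2⟩
  · simpa [Function.comp_def, hc, hc'] using (Complex.continuous_re.tendsto _).comp h1
  · simpa [Function.comp_def, hc, hc'] using ((Complex.continuous_im.tendsto _).comp h1).neg

lemma tendsto_cos_div_rpow_cocompact (d κ : ℝ) {α : ℝ} (hα : 0 < α) :
    Tendsto (fun t : ℝ => d * (cos (κ * t) / (1 + t ^ 2) ^ (α / 2))) (cocompact ℝ) (𝓝 0) := by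
  have h1 : Tendsto (fun t : ℝ => 1 + t ^ 2) (cocompact ℝ) atTop := by
    refine tendsto_atTop_add_const_left _ _ ?_
    have := (tendsto_pow_atTop (two_ne_zero)).comp (tendsto_norm_cocompact_atTop (E := ℝ))
    simpa [Function.comp_def] using this
  have h2 : Tendsto (fun t : ℝ => ((1 + t ^ 2) ^ (α / 2))⁻¹) (cocompact ℝ) (𝓝 0) :=
    ((tendsto_rpow_atTop (by positivity)).comp h1).inv_tendsto_atTop
  have h3 : Tendsto (fun t : ℝ => cos (κ * t) / (1 + t ^ 2) ^ (α / 2)) (cocompact ℝ) (𝓝 0) := by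
    refine squeeze_zero_norm (fun t => ?_) h2
    have : 0 < (1 + t ^ 2) ^ (α / 2) := by positivity
    rw [norm_div, Real.norm_eq_abs, Real.norm_of_nonneg this.le, div_eq_mul_inv]
    exact mul_le_of_le_one_left (by positivity) (abs_cos_le_one _)
  simpa using h3.const_mul d

section Gaussian

variable {Ω : Type*} [MeasurableSpace Ω] {μ : Measure Ω} {ξ : ℝ → Ω → ℝ} {Bcov : ℝ → ℝ}

lemma map_eq_gaussianReal_of_joint (hB0 : Bcov 0 = 1)
    (hgauss : ∀ (n : ℕ) (ts : Fin n → ℝ) (c : Fin n → ℝ),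
      μ.map (fun ω => ∑ i, c i * ξ (ts i) ω) =
        gaussianReal 0 (Real.toNNReal (∑ i, ∑ j, c i * c j * Bcov (ts i - ts j)))) (t : ℝ) :
    μ.map (ξ t) = gaussianReal 0 1 := by
  have := hgauss 1 (fun _ => t) (fun _ => 1)
  simpa [hB0] using this

lemma tendsto_integral_prod_of_separated [IsProbabilityMeasure μ]
    (hξ : ∀ t, Measurable (ξ t)) (hB0 : Bcov 0 = 1) (hB : Tendsto Bcov (cocompact ℝ) (𝓝 0))
    (hgauss : ∀ (n : ℕ) (ts : Fin n → ℝ) (c : Fin n → ℝ),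
      μ.map (fun ω => ∑ i, c i * ξ (ts i) ω) =
        gaussianReal 0 (Real.toNNReal (∑ i, ∑ j, c i * c j * Bcov (ts i - ts j))))
    {m : ℕ} (ts : ℕ → Fin m → ℝ)
    (hts : ∀ i j, i ≠ j → Tendsto (fun n => ts n i - ts n j) atTop (cocompact ℝ))
    (g : BoundedContinuousFunction ℝ ℝ) :
    Tendsto (fun n => ∫ ω, ∏ i, g (ξ (ts n i) ω) ∂μ) atTop
      (𝓝 ((∫ x, g x ∂(gaussianReal 0 1)) ^ m)) := by
  have hmeas : ∀ n, Measurable fun ω => WithLp.toLp 2 fun i => ξ (ts n i) ω := fun n =>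
    (WithLp.measurable_toLp 2 _).comp (measurable_pi_lambda _ fun i => hξ _)
  have : ∀ n, IsProbabilityMeasure (μ.map fun ω => WithLp.toLp 2 fun i => ξ (ts n i) ω) :=
    fun n => Measure.isProbabilityMeasure_map (hmeas n).aemeasurable
  let P : ℕ → ProbabilityMeasure (EuclideanSpace ℝ (Fin m)) := fun n =>
    ⟨μ.map fun ω => WithLp.toLp 2 fun i => ξ (ts n i) ω, this n⟩
  let P₀ : ProbabilityMeasure (EuclideanSpace ℝ (Fin m)) :=
    ⟨stdGaussian (EuclideanSpace ℝ (Fin m)), inferInstance⟩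
  have hP : Tendsto P atTop (𝓝 P₀) := by
    refine ProbabilityMeasure.tendsto_of_tendsto_charFun fun x => ?_
    have h1 : ∀ n, charFun (P n : Measure (EuclideanSpace ℝ (Fin m))) x =
        Complex.exp (-((Real.toNNReal (∑ i, ∑ j, x i * x j * Bcov (ts n i - ts n j)) : ℝ) : ℂ) / 2) := by
      intro n
      have h2 := charFun_gaussianReal (μ := 0)
        (v := Real.toNNReal (∑ i, ∑ j, x i * x j * Bcov (ts n i - ts n j))) 1
      rw [← hgauss, charFun_apply, integral_map
        (Finset.measurable_sum _ fun i _ => (hξ _).const_mul _).aemeasurable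
        (Measurable.aestronglyMeasurable (by fun_prop))] at h2
      change charFun (μ.map _) x = _
      rw [charFun_apply, integral_map (hmeas n).aemeasurable
        (Measurable.aestronglyMeasurable (by fun_prop))]
      convert h2 using 1
      · refine integral_congr_ae (Eventually.of_forall fun ω => ?_)
        simp [PiLp.inner_apply]
      · congr 1
        push_cast
        ring
    have h3 : charFun (P₀ : Measure (EuclideanSpace ℝ (Fin m))) x =
        Complex.exp (-((Real.toNNReal (∑ i, x i * x i) : ℝ) : ℂ) / 2) := by
      change charFun (stdGaussian (EuclideanSpace ℝ (Fin m))) x = _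
      rw [charFun_stdGaussian, Real.coe_toNNReal _ (Finset.sum_nonneg fun i _ => mul_self_nonneg _),
        ← Complex.ofReal_pow, EuclideanSpace.real_norm_sq_eq]
      simp [sq]
    simp_rw [h1, h3]
    have h4 : Tendsto (fun n => ∑ i, ∑ j, x i * x j * Bcov (ts n i - ts n j)) atTop
        (𝓝 (∑ i, x i * x i)) := by
      refine tendsto_finsetSum _ fun i _ => ?_
      have h5 : Tendsto (fun n => ∑ j, x i * x j * Bcov (ts n i - ts n j)) atTop
          (𝓝 (∑ j, if i = j then x i * x j else 0)) := by
        refine tendsto_finsetSum _ fun j _ => ?_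
        split_ifs with hij
        · subst hij
          simp [hB0]
        · simpa using (hB.comp (hts i j hij)).const_mul (x i * x j)
      simpa using h5
    have hcont : Continuous fun r : ℝ => Complex.exp (-((Real.toNNReal r : ℝ) : ℂ) / 2) := by
      fun_prop
    exact (hcont.tendsto _).comp h4
  have hgm : Continuous fun y : EuclideanSpace ℝ (Fin m) => ∏ i, g (y i) := by fun_prop
  let gm : BoundedContinuousFunction (EuclideanSpace ℝ (Fin m)) ℝ :=
    BoundedContinuousFunction.ofNormedAddCommGroup (fun y => ∏ i, g (y i)) hgm (‖g‖ ^ m) fun y => by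
      rw [norm_prod]
      calc ∏ i, ‖g (y i)‖ ≤ ∏ _i : Fin m, ‖g‖ :=
            Finset.prod_le_prod (fun _ _ => norm_nonneg _) fun i _ => g.norm_coe_le_norm _
        _ = ‖g‖ ^ m := by simp
  have h := ProbabilityMeasure.tendsto_iff_forall_integral_tendsto.1 hP gm
  have e1 : ∀ n, ∫ y, gm y ∂(P n : Measure (EuclideanSpace ℝ (Fin m))) =
      ∫ ω, ∏ i, g (ξ (ts n i) ω) ∂μ := fun n =>
    integral_map (hmeas n).aemeasurable hgm.measurable.aestronglyMeasurable
  have e2 : ∫ y, gm y ∂(P₀ : Measure (EuclideanSpace ℝ (Fin m))) =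
      (∫ x, g x ∂(gaussianReal 0 1)) ^ m := by
    change ∫ y, gm y ∂(stdGaussian (EuclideanSpace ℝ (Fin m))) = _
    rw [← map_pi_eq_stdGaussian]
    refine (integral_map (WithLp.measurable_toLp 2 _).aemeasurable
      hgm.measurable.aestronglyMeasurable).trans ?_
    change ∫ y : Fin m → ℝ, ∏ i, g (y i) ∂_ = _
    rw [integral_fintype_prod_eq_pow]
    simp
  rw [e2] at h
  exact h.congr e1

end Gaussian

lemma norm_integral_mul_cexp_sq_le {f : ℝ → ℝ} (hf : Integrable f) (x : ℝ) :
    ‖∫ t, (f t : ℂ) * Complex.exp (x * t * Complex.I)‖ ^ 2 ≤ ∫ u, |∫ t, f t * f (t - u)| := by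
  set F : ℝ → ℂ := fun t => (f t : ℂ) * Complex.exp (x * t * Complex.I)
  set H : ℝ → ℂ := fun t => (f (-t) : ℂ) * Complex.exp (x * t * Complex.I)
  have hE : ∀ t : ℝ, ‖Complex.exp (x * t * Complex.I)‖ = 1 := fun t => by
    rw [← Complex.ofReal_mul, Complex.norm_exp_ofReal_mul_I]
  have hF : Integrable F := hf.ofReal.mul_bdd (c := 1)
    (Measurable.aestronglyMeasurable (by fun_prop)) (Eventually.of_forall fun t => (hE t).le)
  have hH : Integrable H := hf.comp_neg.ofReal.mul_bdd (c := 1)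
    (Measurable.aestronglyMeasurable (by fun_prop)) (Eventually.of_forall fun t => (hE t).le)
  have hHF : ∫ t, H t = (starRingEnd ℂ) (∫ t, F t) := by
    rw [← integral_conj, ← integral_neg_eq_self]
    refine integral_congr_ae (Eventually.of_forall fun t => ?_)
    simp [F, H, ← Complex.exp_conj]
  have h := integral_convolution (ContinuousLinearMap.mul ℝ ℂ) hF hH
  rw [hHF, ContinuousLinearMap.mul_apply', Complex.mul_conj, Complex.normSq_eq_norm_sq] at h
  have h2 : ∀ u : ℝ, ‖convolution F H (ContinuousLinearMap.mul ℝ ℂ) volume u‖ =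
      |∫ t, f t * f (t - u)| := by
    intro u
    have : convolution F H (ContinuousLinearMap.mul ℝ ℂ) volume u =
        Complex.exp (x * u * Complex.I) * ((∫ t, f t * f (t - u) : ℝ) : ℂ) := by
      rw [convolution_def, ← integral_complex_ofReal, ← integral_const_mul]
      refine integral_congr_ae (Eventually.of_forall fun t => ?_)
      have : Complex.exp (x * u * Complex.I) =
          Complex.exp (x * t * Complex.I) * Complex.exp (x * ((u - t : ℝ) : ℂ) * Complex.I) := by
        rw [← Complex.exp_add]
        congr 1
        push_cast
        ring
      simp only [F, H, ContinuousLinearMap.mul_apply', neg_sub, this]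
      push_cast
      ring
    rw [this, norm_mul, hE, one_mul, Complex.norm_real, Real.norm_eq_abs]
  have h3 := norm_integral_le_integral_norm
    (fun u => convolution F H (ContinuousLinearMap.mul ℝ ℂ) volume u) (μ := volume)
  simp_rw [h2] at h3
  rw [h, Complex.norm_real, Real.norm_of_nonneg (sq_nonneg _)] at h3
  exact h3

lemma sq_integral_le_two_mul {r : ℝ → ℝ} (hr : Measurable r) {C : ℝ} (hC : ∀ u, |r u| ≤ C)
    (hsupp : ∀ u, u ∉ Set.Icc (-1 : ℝ) 1 → r u = 0) :
    (∫ u, |r u|) ^ 2 ≤ 2 * ∫ u, r u ^ 2 := by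
  have e1 : ∫ u, |r u| = ∫ u in Set.Icc (-1 : ℝ) 1, |r u| :=
    (setIntegral_eq_integral_of_forall_compl_eq_zero fun u hu => by simp [hsupp u hu]).symm
  have e2 : ∫ u, r u ^ 2 = ∫ u in Set.Icc (-1 : ℝ) 1, r u ^ 2 :=
    (setIntegral_eq_integral_of_forall_compl_eq_zero fun u hu => by simp [hsupp u hu]).symm
  have i1 : IntegrableOn (fun u => |r u|) (Set.Icc (-1 : ℝ) 1) :=
    Measure.integrableOn_of_bounded (M := C) (by simp) (by fun_prop)
      (Eventually.of_forall fun u => by simpa using hC u)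
  have i2 : IntegrableOn (fun u => r u ^ 2) (Set.Icc (-1 : ℝ) 1) :=
    Measure.integrableOn_of_bounded (M := C ^ 2) (by simp) (by fun_prop)
      (Eventually.of_forall fun u => by
        rw [norm_pow, Real.norm_eq_abs]
        exact pow_le_pow_left₀ (abs_nonneg _) (hC u) 2)
  rw [e1, e2]
  set c := ∫ u in Set.Icc (-1 : ℝ) 1, |r u|
  have h : 0 ≤ ∫ u in Set.Icc (-1 : ℝ) 1, (r u ^ 2 - c * |r u| + c ^ 2 / 4) := by
    refine integral_nonneg fun u => ?_
    have := sq_nonneg (|r u| - c / 2)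
    have := sq_abs (r u)
    simp only [Pi.zero_apply]
    nlinarith
  have i3 : IntegrableOn (fun u => r u ^ 2 - c * |r u|) (Set.Icc (-1 : ℝ) 1) :=
    i2.sub (i1.const_mul c)
  rw [integral_add i3 (by simp), integral_sub i2 (i1.const_mul c),
    integral_const_mul] at h
  simp only [integral_const, smul_eq_mul] at h
  norm_num at h
  change 0 ≤ _ - c * c + _ at h
  nlinarith

lemma integrable_of_bounded_of_support {f : ℝ → ℝ} (hf : Measurable f) {C : ℝ}
    (hC : ∀ t, |f t| ≤ C) (hsupp : ∀ t, t ∉ Set.Icc (0 : ℝ) 1 → f t = 0) : Integrable f := by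
  rw [← integrableOn_iff_integrable_of_support_subset (s := Set.Icc (0 : ℝ) 1)
    fun t ht => by_contra fun h => ht (hsupp t h)]
  exact Measure.integrableOn_of_bounded (M := C) (by simp) hf.aestronglyMeasurable
      (Eventually.of_forall fun u => by simpa using hC u)

lemma abs_quadruple_product_le {f : ℝ → ℝ} {C : ℝ}
    (hC : ∀ t, |f t| ≤ C) (hsupp : ∀ t, t ∉ Set.Icc (0 : ℝ) 1 → f t = 0) (p : ℝ × ℝ × ℝ) :
    |f p.2.1 * f (p.2.1 - p.1) * (f p.2.2 * f (p.2.2 - p.1))| ≤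
      (Set.Icc (-1 : ℝ) 1 ×ˢ (Set.Icc (0 : ℝ) 1 ×ˢ Set.Icc (0 : ℝ) 1)).indicator
        (fun _ => C * C * (C * C)) p := by
  have hC0 : 0 ≤ C := (abs_nonneg _).trans (hC 0)
  by_cases hp : p ∈ Set.Icc (-1 : ℝ) 1 ×ˢ (Set.Icc (0 : ℝ) 1 ×ˢ Set.Icc (0 : ℝ) 1)
  · rw [Set.indicator_of_mem hp, abs_mul, abs_mul, abs_mul]
    gcongr <;> exact hC _
  · rw [Set.indicator_of_notMem hp]
    have : f p.2.1 * f (p.2.1 - p.1) * (f p.2.2 * f (p.2.2 - p.1)) = 0 := by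
      by_cases h1 : p.2.1 ∈ Set.Icc (0 : ℝ) 1
      · by_cases h2 : p.2.2 ∈ Set.Icc (0 : ℝ) 1
        · by_cases h3 : p.2.1 - p.1 ∈ Set.Icc (0 : ℝ) 1
          · refine absurd ⟨⟨?_, ?_⟩, h1, h2⟩ hp <;> linarith [h1.1, h1.2, h3.1, h3.2]
          · simp [hsupp _ h3]
        · simp [hsupp _ h2]
      · simp [hsupp _ h1]
    simp [this]

lemma integrable_indicator_box (c : ℝ) :
    Integrable ((Set.Icc (-1 : ℝ) 1 ×ˢ (Set.Icc (0 : ℝ) 1 ×ˢ Set.Icc (0 : ℝ) 1)).indicator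
      fun _ => c) := by
  rw [integrable_indicator_iff (by measurability)]
  refine integrableOn_const ?_
  rw [Measure.volume_eq_prod, Measure.prod_prod, Measure.volume_eq_prod, Measure.prod_prod]
  simp

lemma norm_integral_mul_cexp_pow_four_le {f : ℝ → ℝ} (hf : Measurable f) {C : ℝ}
    (hC : ∀ t, |f t| ≤ C) (hsupp : ∀ t, t ∉ Set.Icc (0 : ℝ) 1 → f t = 0) (x : ℝ) :
    ‖∫ t, (f t : ℂ) * Complex.exp (x * t * Complex.I)‖ ^ 4 ≤
      2 * ∫ p : ℝ × ℝ × ℝ, f p.2.1 * f (p.2.1 - p.1) * (f p.2.2 * f (p.2.2 - p.1)) := by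
  have hC0 : 0 ≤ C := (abs_nonneg _).trans (hC 0)
  have hfi := integrable_of_bounded_of_support hf hC hsupp
  set r : ℝ → ℝ := fun u => ∫ t, f t * f (t - u)
  have hr : Measurable r := by
    have : Measurable fun p : ℝ × ℝ => f p.2 * f (p.2 - p.1) := by fun_prop
    exact this.stronglyMeasurable.integral_prod_right.measurable
  have hrC : ∀ u, |r u| ≤ (∫ t, |f t|) * C := by
    intro u
    rw [← integral_mul_const]
    refine (abs_integral_le_integral_abs).trans (integral_mono_of_nonneg
      (Eventually.of_forall fun _ => abs_nonneg _) (hfi.abs.mul_const C)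
      (Eventually.of_forall fun t => ?_))
    simp only [abs_mul]
    gcongr
    exact hC _
  have hrs : ∀ u, u ∉ Set.Icc (-1 : ℝ) 1 → r u = 0 := by
    intro u hu
    refine (integral_congr_ae (Eventually.of_forall fun t => ?_)).trans (integral_zero _ _)
    by_cases h1 : t ∈ Set.Icc (0 : ℝ) 1
    · by_cases h3 : t - u ∈ Set.Icc (0 : ℝ) 1
      · refine absurd ⟨?_, ?_⟩ hu <;> linarith [h1.1, h1.2, h3.1, h3.2]
      · simp [hsupp _ h3]
    · simp [hsupp _ h1]
  have h1 := norm_integral_mul_cexp_sq_le hfi x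
  have h2 := sq_integral_le_two_mul hr hrC hrs
  have h3 : ∫ p : ℝ × ℝ × ℝ, f p.2.1 * f (p.2.1 - p.1) * (f p.2.2 * f (p.2.2 - p.1)) =
      ∫ u, r u ^ 2 := by
    rw [Measure.volume_eq_prod, integral_prod]
    · refine integral_congr_ae (Eventually.of_forall fun u => ?_)
      simp only [Measure.volume_eq_prod]
      rw [integral_prod_mul (fun t => f t * f (t - u)) fun t => f t * f (t - u), ← sq]
    · refine (integrable_indicator_box (C * C * (C * C))).mono'
        (Measurable.aestronglyMeasurable (by fun_prop))
        (Eventually.of_forall fun p => abs_quadruple_product_le hC hsupp p)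
  rw [h3]
  refine le_trans ?_ h2
  calc _ = (‖∫ t, (f t : ℂ) * Complex.exp (x * t * Complex.I)‖ ^ 2) ^ 2 := by ring
    _ ≤ _ := pow_le_pow_left₀ (sq_nonneg _) h1 2

lemma ae_linearMap_ne_zero {E : Type*} [NormedAddCommGroup E] [NormedSpace ℝ E]
    [FiniteDimensional ℝ E] [MeasurableSpace E] [BorelSpace E] (ν : Measure E)
    [ν.IsAddHaarMeasure] (L : E →ₗ[ℝ] ℝ) {v : E} (hv : L v ≠ 0) : ∀ᵐ p ∂ν, L p ≠ 0 := by
  have := Measure.addHaar_submodule ν (LinearMap.ker L) fun h => hv (by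
    rw [← LinearMap.mem_ker, h]
    trivial)
  rw [ae_iff]
  simp only [ne_eq, not_not]
  exact this

lemma tendsto_mul_const_cocompact {T : ℕ → ℝ} (hT : Tendsto T atTop atTop) {c : ℝ} (hc : c ≠ 0) :
    Tendsto (fun n => T n * c) atTop (cocompact ℝ) := by
  rw [cocompact_eq_atBot_atTop]
  rcases hc.lt_or_gt with h | h
  · exact (hT.atTop_mul_const_of_neg h).mono_right le_sup_left
  · exact (hT.atTop_mul_const h).mono_right le_sup_right

section Gaussian

variable {Ω : Type*} [MeasurableSpace Ω] {μ : Measure Ω} {ξ : ℝ → Ω → ℝ} {Bcov : ℝ → ℝ}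

lemma tendsto_integral_quadruple [IsProbabilityMeasure μ]
    (hξ : Measurable fun p : ℝ × Ω => ξ p.1 p.2) (hB0 : Bcov 0 = 1)
    (hB : Tendsto Bcov (cocompact ℝ) (𝓝 0))
    (hgauss : ∀ (n : ℕ) (ts : Fin n → ℝ) (c : Fin n → ℝ),
      μ.map (fun ω => ∑ i, c i * ξ (ts i) ω) =
        gaussianReal 0 (Real.toNNReal (∑ i, ∑ j, c i * c j * Bcov (ts i - ts j))))
    (g : BoundedContinuousFunction ℝ ℝ) (hg : ∫ x, g x ∂(gaussianReal 0 1) = 0)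
    {T : ℕ → ℝ} (hT : Tendsto T atTop atTop) (f : ℕ → Ω → ℝ → ℝ)
    (hf : ∀ n ω t, f n ω t = (Set.Icc (0 : ℝ) 1).indicator (fun t => g (ξ (T n * t) ω)) t) :
    (∀ n, Integrable (fun ω => ∫ p : ℝ × ℝ × ℝ, f n ω p.2.1 * f n ω (p.2.1 - p.1) *
      (f n ω p.2.2 * f n ω (p.2.2 - p.1))) μ) ∧
    Tendsto (fun n => ∫ ω, (∫ p : ℝ × ℝ × ℝ, f n ω p.2.1 * f n ω (p.2.1 - p.1) *
      (f n ω p.2.2 * f n ω (p.2.2 - p.1))) ∂μ) atTop (𝓝 0) := by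
  have hfm : ∀ n, Measurable fun q : Ω × ℝ => f n q.1 q.2 := by
    intro n
    have h1 : Measurable fun q : Ω × ℝ => g (ξ (T n * q.2) q.1) :=
      g.continuous.measurable.comp (hξ.comp (by fun_prop : Measurable fun q : Ω × ℝ =>
        (T n * q.2, q.1)))
    simp_rw [hf]
    exact h1.indicator (measurable_snd measurableSet_Icc)
  have hfC : ∀ n ω t, |f n ω t| ≤ ‖g‖ := by
    intro n ω t
    rw [hf, ← Real.norm_eq_abs]
    exact (norm_indicator_le_norm_self _ _).trans (g.norm_coe_le_norm _)
  have hfs : ∀ n ω t, t ∉ Set.Icc (0 : ℝ) 1 → f n ω t = 0 := by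
    intro n ω t ht
    rw [hf, Set.indicator_of_notMem ht]
  have hZm : ∀ n, Measurable fun q : Ω × (ℝ × ℝ × ℝ) => f n q.1 q.2.2.1 *
      f n q.1 (q.2.2.1 - q.2.1) * (f n q.1 q.2.2.2 * f n q.1 (q.2.2.2 - q.2.1)) := by
    intro n
    have k : ∀ u : Ω × (ℝ × ℝ × ℝ) → ℝ, Measurable u → Measurable fun q => f n q.1 (u q) :=
      fun u hu => (hfm n).comp (measurable_fst.prodMk hu)
    exact ((k _ (by fun_prop)).mul (k _ (by fun_prop))).mul
      ((k _ (by fun_prop)).mul (k _ (by fun_prop)))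
  have hZi : ∀ n, Integrable (fun q : Ω × (ℝ × ℝ × ℝ) => f n q.1 q.2.2.1 *
      f n q.1 (q.2.2.1 - q.2.1) * (f n q.1 q.2.2.2 * f n q.1 (q.2.2.2 - q.2.1)))
      (μ.prod volume) := by
    intro n
    refine ((integrable_indicator_box (‖g‖ * ‖g‖ * (‖g‖ * ‖g‖))).comp_snd μ).mono'
      (hZm n).aestronglyMeasurable (Eventually.of_forall fun q => ?_)
    exact abs_quadruple_product_le (hfC n q.1) (hfs n q.1) q.2
  have hswap : ∀ n, (∫ ω, (∫ p : ℝ × ℝ × ℝ, f n ω p.2.1 * f n ω (p.2.1 - p.1) *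
      (f n ω p.2.2 * f n ω (p.2.2 - p.1))) ∂μ) = ∫ p : ℝ × ℝ × ℝ, ∫ ω,
        f n ω p.2.1 * f n ω (p.2.1 - p.1) * (f n ω p.2.2 * f n ω (p.2.2 - p.1)) ∂μ :=
    fun n => integral_integral_swap (hZi n)
  refine ⟨fun n => (hZi n).integral_prod_left, ?_⟩
  simp_rw [hswap]
  rw [← integral_zero (ℝ × ℝ × ℝ) ℝ]
  refine tendsto_integral_of_dominated_convergence _ (fun n => ?_)
    (integrable_indicator_box (‖g‖ * ‖g‖ * (‖g‖ * ‖g‖))) (fun n => ?_) ?_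
  · have : Measurable fun q : (ℝ × ℝ × ℝ) × Ω => f n q.2 q.1.2.1 *
      f n q.2 (q.1.2.1 - q.1.1) * (f n q.2 q.1.2.2 * f n q.2 (q.1.2.2 - q.1.1)) :=
      (hZm n).comp measurable_swap
    exact this.stronglyMeasurable.integral_prod_right.aestronglyMeasurable
  · refine Eventually.of_forall fun p => ?_
    refine (norm_integral_le_of_norm_le_const (Eventually.of_forall fun ω =>
      abs_quadruple_product_le (hfC n ω) (hfs n ω) p)).trans ?_
    simp
  · have : (volume : Measure (ℝ × ℝ)).IsAddHaarMeasure := Measure.prod.instIsAddHaarMeasure _ _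
    have : (volume : Measure (ℝ × ℝ × ℝ)).IsAddHaarMeasure :=
      Measure.prod.instIsAddHaarMeasure _ _
    have hne : ∀ a b c : ℝ, (a ≠ 0 ∨ b ≠ 0 ∨ c ≠ 0) →
        ∀ᵐ p : ℝ × ℝ × ℝ, a * p.1 + b * p.2.1 + c * p.2.2 ≠ 0 := by
      intro a b c h
      have := ae_linearMap_ne_zero (volume : Measure (ℝ × ℝ × ℝ))
        (a • LinearMap.fst ℝ ℝ (ℝ × ℝ) + b • (LinearMap.fst ℝ ℝ ℝ ∘ₗ LinearMap.snd ℝ ℝ (ℝ × ℝ)) +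
          c • (LinearMap.snd ℝ ℝ ℝ ∘ₗ LinearMap.snd ℝ ℝ (ℝ × ℝ))) (v := (a, b, c)) (by
          have : 0 < a * a + b * b + c * c := by
            rcases h with h | h | h
            · nlinarith [mul_self_pos.2 h, mul_self_nonneg b, mul_self_nonneg c]
            · nlinarith [mul_self_pos.2 h, mul_self_nonneg a, mul_self_nonneg c]
            · nlinarith [mul_self_pos.2 h, mul_self_nonneg b, mul_self_nonneg a]
          simpa using this.ne')
      simpa using this
    filter_upwards [hne 1 0 0 (by simp), hne 0 1 (-1) (by simp), hne 1 1 (-1) (by simp),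
      hne (-1) 1 (-1) (by simp)] with p h1 h2 h3 h4
    by_cases hS : p.2.1 ∈ Set.Icc (0 : ℝ) 1 ∧ p.2.1 - p.1 ∈ Set.Icc (0 : ℝ) 1 ∧
        p.2.2 ∈ Set.Icc (0 : ℝ) 1 ∧ p.2.2 - p.1 ∈ Set.Icc (0 : ℝ) 1
    · obtain ⟨m1, m2, m3, m4⟩ := hS
      have h := tendsto_integral_prod_of_separated (μ := μ) (ξ := ξ) (fun t => hξ.comp measurable_prodMk_left)
        hB0 hB hgauss (m := 4)
        (fun n i => T n * ![p.2.1, p.2.1 - p.1, p.2.2, p.2.2 - p.1] i) (by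
          intro i j hij
          simp_rw [← mul_sub]
          refine tendsto_mul_const_cocompact hT fun h0 => ?_
          fin_cases i <;> fin_cases j <;> simp at hij h0 <;> simp at h1 h2 h3 h4 <;>
            first
            | exact h1 (by linarith)
            | exact h2 (by linarith)
            | exact h3 (by linarith)
            | exact h4 (by linarith)) g
      simpa [hg, Fin.prod_univ_four, hf, m1, m2, m3, m4, mul_assoc,
        -Set.mem_Icc] using h
    · have : ∀ n ω, f n ω p.2.1 * f n ω (p.2.1 - p.1) *
          (f n ω p.2.2 * f n ω (p.2.2 - p.1)) = 0 := by
        intro n ω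
        contrapose! hS
        simp only [ne_eq, mul_eq_zero, not_or] at hS
        exact ⟨by_contra fun h => hS.1.1 (hfs n ω _ h), by_contra fun h => hS.1.2 (hfs n ω _ h),
          by_contra fun h => hS.2.1 (hfs n ω _ h), by_contra fun h => hS.2.2 (hfs n ω _ h)⟩
      simp [this]

end Gaussian

section Gaussian

variable {Ω : Type*} [MeasurableSpace Ω] {μ : Measure Ω} {ξ : ℝ → Ω → ℝ} {Bcov : ℝ → ℝ}

lemma tendsto_measure_periodogram_of_bounded [IsProbabilityMeasure μ]
    (hξ : Measurable fun p : ℝ × Ω => ξ p.1 p.2) (hB0 : Bcov 0 = 1)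
    (hB : Tendsto Bcov (cocompact ℝ) (𝓝 0))
    (hgauss : ∀ (n : ℕ) (ts : Fin n → ℝ) (c : Fin n → ℝ),
      μ.map (fun ω => ∑ i, c i * ξ (ts i) ω) =
        gaussianReal 0 (Real.toNNReal (∑ i, ∑ j, c i * c j * Bcov (ts i - ts j))))
    (g : BoundedContinuousFunction ℝ ℝ) (hg : ∫ x, g x ∂(gaussianReal 0 1) = 0)
    {T : ℕ → ℝ} (hT : Tendsto T atTop atTop) {δ : ℝ} (hδ : 0 < δ) :
    Tendsto (fun n => μ {ω | ∃ x : ℝ,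
      δ < ‖∫ t in (0:ℝ)..1, (g (ξ (T n * t) ω) : ℂ) * Complex.exp (x * t * Complex.I)‖})
      atTop (𝓝 0) := by
  set f : ℕ → Ω → ℝ → ℝ := fun n ω =>
    (Set.Icc (0 : ℝ) 1).indicator fun t => g (ξ (T n * t) ω)
  obtain ⟨hi, hlim⟩ := tendsto_integral_quadruple hξ hB0 hB hgauss g hg hT f fun _ _ _ => rfl
  set V : ℕ → Ω → ℝ := fun n ω => ∫ p : ℝ × ℝ × ℝ, f n ω p.2.1 * f n ω (p.2.1 - p.1) *
    (f n ω p.2.2 * f n ω (p.2.2 - p.1))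
  have hV : ∀ n ω (x : ℝ),
      ‖∫ t in (0:ℝ)..1, (g (ξ (T n * t) ω) : ℂ) * Complex.exp (x * t * Complex.I)‖ ^ 4 ≤
        2 * V n ω := by
    intro n ω x
    have hm : Measurable (f n ω) := by
      refine Measurable.indicator ?_ measurableSet_Icc
      exact g.continuous.measurable.comp (hξ.comp (by fun_prop : Measurable fun t : ℝ =>
        (T n * t, ω)))
    have := norm_integral_mul_cexp_pow_four_le hm (C := ‖g‖) (fun t =>
      (norm_indicator_le_norm_self (fun t => g (ξ (T n * t) ω)) t).trans (g.norm_coe_le_norm _))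
      (fun t ht => Set.indicator_of_notMem ht _) x
    refine le_of_eq_of_le ?_ this
    congr 2
    rw [intervalIntegral.integral_of_le zero_le_one, ← integral_Icc_eq_integral_Ioc,
      ← integral_indicator measurableSet_Icc]
    refine integral_congr_ae (Eventually.of_forall fun t => ?_)
    by_cases ht : t ∈ Set.Icc (0 : ℝ) 1
    · simp only [f, Set.indicator_of_mem ht]
    · simp only [f, Set.indicator_of_notMem ht, Complex.ofReal_zero, zero_mul]
  have hV0 : ∀ n ω, 0 ≤ V n ω := fun n ω => by
    have := (pow_nonneg (norm_nonneg _) 4).trans (hV n ω 0)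
    linarith
  have hlim2 : Tendsto (fun n => ENNReal.ofReal ((∫ ω, V n ω ∂μ) / (δ ^ 4 / 2))) atTop (𝓝 0) := by
    have := ENNReal.tendsto_ofReal (hlim.div_const (δ ^ 4 / 2))
    simpa using this
  refine tendsto_of_tendsto_of_tendsto_of_le_of_le tendsto_const_nhds hlim2
    (fun _ => zero_le) fun n => ?_
  have hsub : {ω | ∃ x : ℝ, δ < ‖∫ t in (0:ℝ)..1, (g (ξ (T n * t) ω) : ℂ) *
      Complex.exp (x * t * Complex.I)‖} ⊆ {ω | δ ^ 4 / 2 ≤ V n ω} := by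
    rintro ω ⟨x, hx⟩
    have := (pow_le_pow_left₀ hδ.le hx.le 4).trans (hV n ω x)
    simp only [Set.mem_ofPred_eq]
    linarith
  refine (measure_mono hsub).trans ?_
  have hM := mul_meas_ge_le_integral_of_nonneg (Eventually.of_forall (hV0 n)) (hi n) (δ ^ 4 / 2)
  rw [← ofReal_measureReal]
  refine ENNReal.ofReal_le_ofReal ?_
  rw [le_div_iff₀ (by positivity), mul_comm]
  exact hM

lemma lintegral_lintegral_comp_process [IsProbabilityMeasure μ]
    (hξ : Measurable fun p : ℝ × Ω => ξ p.1 p.2)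
    {γ : Measure ℝ} (hlaw : ∀ t, μ.map (ξ t) = γ) {h : ℝ → ENNReal} (hh : Measurable h) (T : ℝ) :
    ∫⁻ ω, (∫⁻ t in Set.Ioc (0 : ℝ) 1, h (ξ (T * t) ω)) ∂μ = ∫⁻ x, h x ∂γ := by
  rw [lintegral_lintegral_swap]
  · have : ∀ t : ℝ, ∫⁻ ω, h (ξ (T * t) ω) ∂μ = ∫⁻ x, h x ∂γ := fun t => by
      have hξt : Measurable (ξ (T * t)) := hξ.comp measurable_prodMk_left
      rw [← hlaw (T * t), lintegral_map hh hξt]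
    simp [this]
  · exact (hh.comp (hξ.comp (by fun_prop : Measurable fun q : Ω × ℝ =>
      (T * q.2, q.1)))).aemeasurable

lemma ae_intervalIntegrable_comp_process [IsProbabilityMeasure μ]
    (hξ : Measurable fun p : ℝ × Ω => ξ p.1 p.2)
    {γ : Measure ℝ} (hlaw : ∀ t, μ.map (ξ t) = γ) {h : ℝ → ℝ} (hh : Measurable h)
    (hi : Integrable h γ) (T : ℝ) :
    ∀ᵐ ω ∂μ, IntervalIntegrable (fun t => h (ξ (T * t) ω)) volume 0 1 := by
  have hm : Measurable fun q : Ω × ℝ => ‖h (ξ (T * q.2) q.1)‖ₑ :=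
    (hh.comp (hξ.comp (by fun_prop : Measurable fun q : Ω × ℝ => (T * q.2, q.1)))).enorm
  have h1 := lintegral_lintegral_comp_process hξ hlaw hh.enorm T
  have h2 : ∫⁻ ω, (∫⁻ t in Set.Ioc (0 : ℝ) 1, ‖h (ξ (T * t) ω)‖ₑ) ∂μ ≠ ⊤ := by
    rw [h1]
    exact hi.2.ne
  filter_upwards [ae_lt_top hm.lintegral_prod_right' h2] with ω hω
  rw [intervalIntegrable_iff_integrableOn_Ioc_of_le zero_le_one]
  exact ⟨(hh.comp (hξ.comp (by fun_prop : Measurable fun t : ℝ =>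
    (T * t, ω)))).aestronglyMeasurable, hω⟩

lemma tendsto_measure_periodogram [IsProbabilityMeasure μ]
    (hξ : Measurable fun p : ℝ × Ω => ξ p.1 p.2) (hB0 : Bcov 0 = 1)
    (hB : Tendsto Bcov (cocompact ℝ) (𝓝 0))
    (hgauss : ∀ (n : ℕ) (ts : Fin n → ℝ) (c : Fin n → ℝ),
      μ.map (fun ω => ∑ i, c i * ξ (ts i) ω) =
        gaussianReal 0 (Real.toNNReal (∑ i, ∑ j, c i * c j * Bcov (ts i - ts j))))
    {G : ℝ → ℝ} (hGm : Measurable G) (hGi : Integrable G (gaussianReal 0 1))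
    (hG : ∫ x, G x ∂(gaussianReal 0 1) = 0)
    {T : ℕ → ℝ} (hT : Tendsto T atTop atTop) {δ : ℝ} (hδ : 0 < δ) :
    Tendsto (fun n => μ {ω | ∃ x : ℝ,
      δ < ‖∫ t in (0:ℝ)..1, (G (ξ (T n * t) ω) : ℂ) * Complex.exp (x * t * Complex.I)‖})
      atTop (𝓝 0) := by
  rw [ENNReal.tendsto_nhds_zero]
  intro ε hε
  rcases eq_or_ne ε ⊤ with rfl | hεt
  · simp
  have hε' : 0 < ε.toReal := ENNReal.toReal_pos hε.ne' hεt
  obtain ⟨g₀, hg₀, hg₀i⟩ := hGi.exists_boundedContinuous_integral_sub_le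
    (show 0 < ε.toReal * δ / 8 by positivity)
  set c := ∫ x, g₀ x ∂(gaussianReal 0 1)
  have hc : |c| ≤ ε.toReal * δ / 8 := by
    have : c = -∫ x, (G x - g₀ x) ∂(gaussianReal 0 1) := by
      rw [integral_sub hGi hg₀i, hG]
      simp [c]
    rw [this, abs_neg]
    exact (norm_integral_le_integral_norm _).trans hg₀
  set g : BoundedContinuousFunction ℝ ℝ := g₀ - BoundedContinuousFunction.const ℝ c with hgdef
  have hgx : ∀ x, g x = g₀ x - c := fun x => by simp [hgdef]
  have hg : ∫ x, g x ∂(gaussianReal 0 1) = 0 := by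
    simp_rw [hgx]
    rw [integral_sub hg₀i (integrable_const _)]
    simp [c]
  have hR : ∫⁻ x, ‖G x - g x‖ₑ ∂(gaussianReal 0 1) ≤ ENNReal.ofReal (ε.toReal * δ / 4) := by
    have hi : Integrable (fun x => G x - g₀ x) (gaussianReal 0 1) := hGi.sub hg₀i
    have h1 : ∫ x, ‖G x - g x‖ ∂(gaussianReal 0 1) ≤ ε.toReal * δ / 4 := by
      calc ∫ x, ‖G x - g x‖ ∂(gaussianReal 0 1)
          ≤ ∫ x, (‖G x - g₀ x‖ + |c|) ∂(gaussianReal 0 1) := by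
            refine integral_mono_of_nonneg (Eventually.of_forall fun _ => norm_nonneg _)
              (hi.norm.add (integrable_const _)) (Eventually.of_forall fun x => ?_)
            simp only [hgx]
            rw [show G x - (g₀ x - c) = (G x - g₀ x) + c by ring]
            exact norm_add_le _ _
        _ ≤ _ := by
            rw [integral_add hi.norm (integrable_const _)]
            simp only [integral_const, probReal_univ, one_smul]
            linarith
    have hi2 : Integrable (fun x => G x - g x) (gaussianReal 0 1) := by
      simp_rw [hgx]
      exact hGi.sub (hg₀i.sub (integrable_const _))
    rw [← ofReal_integral_norm_eq_lintegral_enorm hi2]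
    exact ENNReal.ofReal_le_ofReal h1
  have hRm : Measurable fun x => G x - g x := hGm.sub g.continuous.measurable
  have hlaw := map_eq_gaussianReal_of_joint hB0 hgauss
  filter_upwards [(ENNReal.tendsto_nhds_zero.1 (tendsto_measure_periodogram_of_bounded hξ hB0 hB
    hgauss g hg hT (half_pos hδ))) (ε / 2) (ENNReal.half_pos hε.ne')] with n hn
  set W : Ω → ENNReal := fun ω => ∫⁻ t in Set.Ioc (0 : ℝ) 1, ‖G (ξ (T n * t) ω) - g (ξ (T n * t) ω)‖ₑ
  have hsub : {ω | ∃ x : ℝ, δ < ‖∫ t in (0:ℝ)..1, (G (ξ (T n * t) ω) : ℂ) *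
      Complex.exp (x * t * Complex.I)‖} ⊆ {ω | ∃ x : ℝ, δ / 2 < ‖∫ t in (0:ℝ)..1,
        (g (ξ (T n * t) ω) : ℂ) * Complex.exp (x * t * Complex.I)‖} ∪
          {ω | ENNReal.ofReal (δ / 2) ≤ W ω} := by
    intro ω hω
    by_contra hcon
    simp only [Set.mem_union, Set.mem_ofPred_eq, not_or, not_exists, not_lt, not_le] at hcon hω
    obtain ⟨x, hx⟩ := hω
    obtain ⟨h1, h2⟩ := hcon
    have hξt : Measurable fun t => ξ (T n * t) ω :=
      hξ.comp (by fun_prop : Measurable fun t : ℝ => (T n * t, ω))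
    have hE : ∀ t : ℝ, ‖Complex.exp (x * t * Complex.I)‖ = 1 := fun t => by
      rw [← Complex.ofReal_mul, Complex.norm_exp_ofReal_mul_I]
    have hRi : IntegrableOn (fun t => G (ξ (T n * t) ω) - g (ξ (T n * t) ω)) (Set.Ioc 0 1) :=
      ⟨(hRm.comp hξt).aestronglyMeasurable, h2.trans ENNReal.ofReal_lt_top⟩
    have hgi : IntegrableOn (fun t => g (ξ (T n * t) ω)) (Set.Ioc 0 1) :=
      Measure.integrableOn_of_bounded (M := ‖g‖) (by simp)
        (g.continuous.measurable.comp hξt).aestronglyMeasurable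
        (Eventually.of_forall fun t => g.norm_coe_le_norm _)
    have hRi2 : IntegrableOn (fun t => ((G (ξ (T n * t) ω) - g (ξ (T n * t) ω) : ℝ) : ℂ) *
        Complex.exp (x * t * Complex.I)) (Set.Ioc 0 1) := hRi.ofReal.mul_bdd (c := 1)
      (Measurable.aestronglyMeasurable (by fun_prop)) (Eventually.of_forall fun t => (hE t).le)
    have hgi2 : IntegrableOn (fun t => ((g (ξ (T n * t) ω) : ℝ) : ℂ) *
        Complex.exp (x * t * Complex.I)) (Set.Ioc 0 1) := hgi.ofReal.mul_bdd (c := 1)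
      (Measurable.aestronglyMeasurable (by fun_prop)) (Eventually.of_forall fun t => (hE t).le)
    have hsplit : ∫ t in (0:ℝ)..1, (G (ξ (T n * t) ω) : ℂ) * Complex.exp (x * t * Complex.I) =
        (∫ t in (0:ℝ)..1, (g (ξ (T n * t) ω) : ℂ) * Complex.exp (x * t * Complex.I)) +
        ∫ t in Set.Ioc (0:ℝ) 1, ((G (ξ (T n * t) ω) - g (ξ (T n * t) ω) : ℝ) : ℂ) *
          Complex.exp (x * t * Complex.I) := by
      rw [intervalIntegral.integral_of_le zero_le_one, intervalIntegral.integral_of_le zero_le_one,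
        ← integral_add hgi2 hRi2]
      refine integral_congr_ae (Eventually.of_forall fun t => ?_)
      simp only
      push_cast
      ring
    have h3 : ‖∫ t in Set.Ioc (0:ℝ) 1, ((G (ξ (T n * t) ω) - g (ξ (T n * t) ω) : ℝ) : ℂ) *
        Complex.exp (x * t * Complex.I)‖ ≤ δ / 2 := by
      have h4 := (enorm_integral_le_lintegral_enorm (μ := volume.restrict (Set.Ioc (0:ℝ) 1))
        fun t : ℝ => ((G (ξ (T n * t) ω) - g (ξ (T n * t) ω) : ℝ) : ℂ) *
          Complex.exp (x * t * Complex.I))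
      have h5 : ∀ t : ℝ, ‖((G (ξ (T n * t) ω) - g (ξ (T n * t) ω) : ℝ) : ℂ) *
          Complex.exp (x * t * Complex.I)‖ₑ = ‖G (ξ (T n * t) ω) - g (ξ (T n * t) ω)‖ₑ := by
        intro t
        rw [← ofReal_norm, ← ofReal_norm, norm_mul, hE, mul_one, Complex.norm_real]
      simp_rw [h5] at h4
      rw [← ofReal_norm] at h4
      exact (ENNReal.ofReal_le_ofReal_iff (half_pos hδ).le).1 (h4.trans h2.le)
    have h6 := norm_add_le (∫ t in (0:ℝ)..1, (g (ξ (T n * t) ω) : ℂ) *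
      Complex.exp (x * t * Complex.I)) (∫ t in Set.Ioc (0:ℝ) 1,
        ((G (ξ (T n * t) ω) - g (ξ (T n * t) ω) : ℝ) : ℂ) * Complex.exp (x * t * Complex.I))
    rw [← hsplit] at h6
    linarith [h1 x]
  have hW : μ {ω | ENNReal.ofReal (δ / 2) ≤ W ω} ≤ ε / 2 := by
    have hWm : Measurable W := by
      have : Measurable fun q : Ω × ℝ => ‖G (ξ (T n * q.2) q.1) - g (ξ (T n * q.2) q.1)‖ₑ :=
        (hRm.comp (hξ.comp (by fun_prop : Measurable fun q : Ω × ℝ => (T n * q.2, q.1)))).enorm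
      exact this.lintegral_prod_right'
    have hδ0 : ENNReal.ofReal (δ / 2) ≠ 0 := by simpa using hδ
    refine (meas_ge_le_lintegral_div hWm.aemeasurable hδ0 ENNReal.ofReal_ne_top).trans ?_
    rw [lintegral_lintegral_comp_process hξ hlaw hRm.enorm]
    refine ENNReal.div_le_of_le_mul (hR.trans_eq ?_)
    rw [show ε.toReal * δ / 4 = ε.toReal / 2 * (δ / 2) by ring,
      ENNReal.ofReal_mul (by positivity), ENNReal.ofReal_div_of_pos two_pos,
      ENNReal.ofReal_toReal hεt]
    simp
  calc _ ≤ _ := measure_mono hsub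
    _ ≤ _ := measure_union_le _ _
    _ ≤ ε / 2 + ε / 2 := add_le_add hn hW
    _ = ε := ENNReal.add_halves ε

end Gaussian

lemma le_mul_sub_of_mem_closure {N : ℕ} {S : Set (Fin N → ℝ)} {M T : ℝ} {j k : Fin N}
    (h : ∀ ψ ∈ S, M ≤ T * (ψ k - ψ j)) {ψ : Fin N → ℝ} (hψ : ψ ∈ closure S) :
    M ≤ T * (ψ k - ψ j) :=
  closure_minimal (t := {ψ : Fin N → ℝ | M ≤ T * (ψ k - ψ j)}) h
    (isClosed_le continuous_const (by fun_prop)) hψ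

lemma le_mul_of_mem_closure {N : ℕ} {S : Set (Fin N → ℝ)} {M T : ℝ} {k : Fin N}
    (h : ∀ ψ ∈ S, M ≤ T * ψ k) {ψ : Fin N → ℝ} (hψ : ψ ∈ closure S) : M ≤ T * ψ k :=
  closure_minimal (t := {ψ : Fin N → ℝ | M ≤ T * ψ k}) h
    (isClosed_le continuous_const (by fun_prop)) hψ

/-- The frequencies of a Walker parameter set are well separated and far from zero, so a small
noise periodogram forces every competitor beating the true parameter to be close to it. -/
lemma exists_noise_threshold {N : ℕ} (hN : 0 < N) {A B φ : Fin N → ℝ}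
    (hAB : ∀ k, 0 < A k ^ 2 + B k ^ 2) (hφmono : StrictMono φ) (hφpos : ∀ k, 0 < φ k)
    {S : ℝ → Set (Fin N → ℝ)}
    (hSsep : ∀ M : ℝ, ∃ T₁ : ℝ, ∀ T, T₁ ≤ T → ∀ ψ ∈ S T, ∀ j k : Fin N, j < k →
      M ≤ T * (ψ k - ψ j))
    (hSfirst : ∀ M : ℝ, ∃ T₁ : ℝ, ∀ T, T₁ ≤ T → ∀ ψ ∈ S T, M ≤ T * ψ ⟨0, hN⟩)
    {ε : ℝ} (hε : 0 < ε) :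
    ∃ δ > 0, ∃ T₁ : ℝ, ∀ T ≥ T₁, ∀ (a b ψ : Fin N → ℝ) (X : ℝ → ℝ), ψ ∈ closure (S T) →
      IntervalIntegrable X volume 0 1 → IntervalIntegrable (fun t => X t ^ 2) volume 0 1 →
      (∀ x : ℝ, ‖∫ t in (0:ℝ)..1, (X t : ℂ) * Complex.exp (x * t * Complex.I)‖ ≤ δ) →
      ∫ t in (0:ℝ)..1, ((∑ k, (A k * cos (T * φ k * t) + B k * sin (T * φ k * t))) + X t
        - ∑ k, (a k * cos (T * ψ k * t) + b k * sin (T * ψ k * t))) ^ 2 ≤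
          ∫ t in (0:ℝ)..1, X t ^ 2 →
      ∀ k, |a k - A k| < ε ∧ |b k - B k| < ε ∧ |T * (ψ k - φ k)| < ε := by
  by_contra hcon
  have hex : ∀ m : ℕ, ∃ (T : ℝ) (a b ψ : Fin N → ℝ) (X : ℝ → ℝ), (m : ℝ) ≤ T ∧
      ψ ∈ closure (S T) ∧
      IntervalIntegrable X volume 0 1 ∧ IntervalIntegrable (fun t => X t ^ 2) volume 0 1 ∧
      (∀ x : ℝ, ‖∫ t in (0:ℝ)..1, (X t : ℂ) * Complex.exp (x * t * Complex.I)‖ ≤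
        1 / ((m : ℝ) + 1)) ∧
      ∫ t in (0:ℝ)..1, ((∑ k, (A k * cos (T * φ k * t) + B k * sin (T * φ k * t))) + X t
        - ∑ k, (a k * cos (T * ψ k * t) + b k * sin (T * ψ k * t))) ^ 2 ≤
          ∫ t in (0:ℝ)..1, X t ^ 2 ∧
      ¬ ∀ k, |a k - A k| < ε ∧ |b k - B k| < ε ∧ |T * (ψ k - φ k)| < ε := by
    intro m
    by_contra h
    refine hcon ⟨1 / ((m : ℝ) + 1), by positivity, m, ?_⟩
    intro T hT a b ψ X h1 h2 h3 h4 h5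
    by_contra h6
    exact h ⟨T, a, b, ψ, X, hT, h1, h2, h3, h4, h5, h6⟩
  choose T a b ψ X hT hψ hX hX2 hδ hle hbad using hex
  have hT' : Tendsto T atTop atTop := tendsto_atTop_mono hT tendsto_natCast_atTop_atTop
  have hsep : ∀ j k, j < k → Tendsto (fun m => T m * ψ m k - T m * ψ m j) atTop atTop := by
    intro j k hjk
    refine tendsto_atTop.2 fun M => ?_
    obtain ⟨T₁, h⟩ := hSsep M
    filter_upwards [hT'.eventually_ge_atTop T₁] with m hm
    rw [← mul_sub]
    exact le_mul_sub_of_mem_closure (fun ψ' h' => h _ hm ψ' h' j k hjk) (hψ m)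
  have hfirst : Tendsto (fun m => T m * ψ m ⟨0, hN⟩) atTop atTop := by
    refine tendsto_atTop.2 fun M => ?_
    obtain ⟨T₁, h⟩ := hSfirst M
    filter_upwards [hT'.eventually_ge_atTop T₁] with m hm
    exact le_mul_of_mem_closure (h _ hm) (hψ m)
  have key := tendsto_of_least_squares A B hAB (fun m k => T m * φ k) (fun m k => T m * ψ m k)
    a b X (l := atTop)
    (fun j k hjk => by
      simp_rw [← mul_sub]
      exact hT'.atTop_mul_const (sub_pos.2 (hφmono hjk)))
    hsep (fun k => hT'.atTop_mul_const (hφpos k))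
    (fun k => by
      rcases eq_or_ne k ⟨0, hN⟩ with rfl | hk
      · exact hfirst
      · have hlt : (⟨0, hN⟩ : Fin N) < k :=
          lt_of_le_of_ne (Fin.le_def.2 (Nat.zero_le _)) hk.symm
        simpa using hfirst.atTop_add_atTop (hsep _ _ hlt))
    hX hX2 (fun m => 1 / ((m : ℝ) + 1)) tendsto_one_div_add_atTop_nhds_zero_nat hδ
    (Eventually.of_forall hle)
  have hev : ∀ᶠ m in atTop, ∀ k, |a m k - A k| < ε ∧ |b m k - B k| < ε ∧
      |T m * (ψ m k - φ k)| < ε := by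
    refine eventually_all.2 fun k => ?_
    obtain ⟨h1, h2, h3⟩ := key k
    filter_upwards [Metric.tendsto_nhds.1 h1 ε hε, Metric.tendsto_nhds.1 h2 ε hε,
      Metric.tendsto_nhds.1 h3 ε hε] with m e1 e2 e3
    refine ⟨e1, e2, ?_⟩
    rw [mul_sub]
    simpa using e3
  obtain ⟨m, hm⟩ := hev.exists
  exact hbad m hm

lemma gaussianPDFReal_zero_one (x : ℝ) :
    gaussianPDFReal 0 1 x = (√(2 * π))⁻¹ * exp (-(x ^ 2) / 2) := by
  simp [gaussianPDFReal]

lemma integrable_gaussianReal_iff {f : ℝ → ℝ} :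
    Integrable f (gaussianReal 0 1) ↔
      Integrable fun x => f x * ((√(2 * π))⁻¹ * exp (-(x ^ 2) / 2)) := by
  rw [gaussianReal_of_var_ne_zero _ one_ne_zero, integrable_withDensity_iff_integrable_smul'
    (measurable_gaussianPDF _ _) (Eventually.of_forall fun _ => gaussianPDF_lt_top)]
  simp [gaussianPDFReal_zero_one, mul_comm]

lemma inv_mul_integral_Ioc_eq_integral_comp_mul {T : ℝ} (hT : 0 < T) (F : ℝ → ℝ) :
    (1 / T) * ∫ t in Set.Ioc (0 : ℝ) T, F t = ∫ t in (0:ℝ)..1, F (T * t) := by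
  rw [intervalIntegral.integral_comp_mul_left F hT.ne', mul_zero, mul_one,
    intervalIntegral.integral_of_le hT.le, smul_eq_mul, one_div]

/-- **Theorem 1 (consistency of the Walker least-squares estimator).**
Consider the regression model `x(t) = Σ_{k} (A_k cos(φ_k t) + B_k sin(φ_k t)) + G(ξ(t))`,
`t ∈ [0,T]`, where (A1) `ξ` is a measurable stationary zero-mean, unit-variance Gaussian
process with covariance `B(t) = Σ_j D_j cos(ϰ_j t)/(1+t²)^{α_j/2}` (`D_j ≥ 0`, `Σ D_j = 1`,
`α_j > 0`, `0 ≤ ϰ_0 < ⋯ < ϰ_κ`), and (A2) `G` is measurable with `E G(ξ(0)) = 0` and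
`E G²(ξ(0)) < ∞`. Then any least-squares estimator in the Walker sense
`θ̂_T = (Â_T, B̂_T, φ̂_T)` (minimizing `Q_T` over `Θ_T`) is weakly consistent:
`Â_{kT} → A_k`, `B̂_{kT} → B_k` and `T(φ̂_{kT} − φ_k) → 0` in probability as `T → ∞`. -/
theorem walker_lse_consistency
    {Ω : Type*} [MeasurableSpace Ω] (μ : Measure Ω) [IsProbabilityMeasure μ]
    -- the trigonometric regression function and its true parameters
    (N : ℕ) (hN : 0 < N) (A B φ : Fin N → ℝ)
    (hAB : ∀ k, 0 < A k ^ 2 + B k ^ 2)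
    (φlow φhigh : ℝ) (hφlow : 0 ≤ φlow) (hφmono : StrictMono φ)
    (hφgt : ∀ k, φlow < φ k) (hφlt : ∀ k, φ k < φhigh)
    -- condition A1: the Gaussian process ξ and its covariance function
    (κ : ℕ) (D αv κv : Fin (κ + 1) → ℝ)
    (hD : ∀ j, 0 ≤ D j) (hDsum : ∑ j, D j = 1)
    (hαv : ∀ j, 0 < αv j) (hκ0 : 0 ≤ κv 0) (hκmono : StrictMono κv)
    (Bcov : ℝ → ℝ)
    (hBcov : ∀ t, Bcov t = ∑ j, D j * (Real.cos (κv j * t) / (1 + t ^ 2) ^ (αv j / 2)))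
    (ξ : ℝ → Ω → ℝ) (hξmeas : Measurable fun p : ℝ × Ω => ξ p.1 p.2)
    (hgauss : ∀ (n : ℕ) (ts : Fin n → ℝ) (c : Fin n → ℝ),
      μ.map (fun ω => ∑ i, c i * ξ (ts i) ω) =
        gaussianReal 0 (Real.toNNReal (∑ i, ∑ j, c i * c j * Bcov (ts i - ts j))))
    -- condition A2: the noise ε(t) = G(ξ(t))
    (G : ℝ → ℝ) (hGmeas : Measurable G)
    (hGmean : ∫ x : ℝ, G x * ((Real.sqrt (2 * π))⁻¹ * Real.exp (-(x ^ 2) / 2)) = 0)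
    (hGL2 : Integrable (fun x : ℝ => G x ^ 2 * ((Real.sqrt (2 * π))⁻¹ * Real.exp (-(x ^ 2) / 2))))
    -- the observed process
    (xobs : ℝ → Ω → ℝ)
    (hx : ∀ t ω, xobs t ω =
      (∑ k, (A k * Real.cos (φ k * t) + B k * Real.sin (φ k * t))) + G (ξ t ω))
    -- the Walker parameter sets S_T
    (T₀ : ℝ) (hT₀ : 0 < T₀) (ST : ℝ → Set (Fin N → ℝ))
    (hSopen : ∀ T, IsOpen (ST T))
    (hSmono : ∀ T₁ T₂, T₁ ≤ T₂ → ST T₁ ⊆ ST T₂)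
    (hStrue : ∀ T, T₀ < T → φ ∈ ST T)
    (hSsub : ∀ T, ST T ⊆ {ψ : Fin N → ℝ | StrictMono ψ ∧ (∀ k, φlow < ψ k) ∧ ∀ k, ψ k < φhigh})
    (hSsep : ∀ M : ℝ, ∃ T₁ : ℝ, ∀ T, T₁ ≤ T → ∀ ψ ∈ ST T, ∀ j k : Fin N, j < k →
      M ≤ T * (ψ k - ψ j))
    (hSfirst : ∀ M : ℝ, ∃ T₁ : ℝ, ∀ T, T₁ ≤ T → ∀ ψ ∈ ST T, M ≤ T * ψ ⟨0, hN⟩)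
    -- the least-squares estimator in the Walker sense
    (Aest Best φest : ℝ → Ω → Fin N → ℝ)
    (hestmeas : ∀ T, Measurable (Aest T) ∧ Measurable (Best T) ∧ Measurable (φest T))
    (hLSE : ∀ T, T₀ < T → ∀ ω, φest T ω ∈ closure (ST T) ∧
      ∀ a b ψ : Fin N → ℝ, ψ ∈ closure (ST T) →
        (1 / T) * ∫ t in Set.Ioc (0 : ℝ) T, (xobs t ω -
            ∑ k, (Aest T ω k * Real.cos (φest T ω k * t)
              + Best T ω k * Real.sin (φest T ω k * t))) ^ 2 ≤
        (1 / T) * ∫ t in Set.Ioc (0 : ℝ) T, (xobs t ω -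
            ∑ k, (a k * Real.cos (ψ k * t) + b k * Real.sin (ψ k * t))) ^ 2) :
    -- conclusion: weak consistency
    ∀ k : Fin N,
      TendstoInMeasure μ (fun T ω => Aest T ω k) atTop (fun _ => A k) ∧
      TendstoInMeasure μ (fun T ω => Best T ω k) atTop (fun _ => B k) ∧
      TendstoInMeasure μ (fun T ω => T * (φest T ω k - φ k)) atTop (fun _ => 0) := by
  have hφpos : ∀ k, 0 < φ k := fun k => hφlow.trans_lt (hφgt k)
  have hB0 : Bcov 0 = 1 := by simp [hBcov, hDsum]
  have hB : Tendsto Bcov (cocompact ℝ) (𝓝 0) := by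
    have := tendsto_finsetSum Finset.univ fun j _ =>
      tendsto_cos_div_rpow_cocompact (D j) (κv j) (hαv j)
    simpa [← hBcov] using this
  have hlaw := map_eq_gaussianReal_of_joint hB0 hgauss
  have hG2 : Integrable (fun x => G x ^ 2) (gaussianReal 0 1) := integrable_gaussianReal_iff.2 hGL2
  have hG1 : Integrable G (gaussianReal 0 1) :=
    ((memLp_two_iff_integrable_sq hGmeas.aestronglyMeasurable).2 hG2).integrable one_le_two
  have hG0 : ∫ x, G x ∂(gaussianReal 0 1) = 0 := by
    rw [integral_gaussianReal_eq_integral_smul one_ne_zero]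
    simpa [gaussianPDFReal_zero_one, mul_comm] using hGmean
  have hnoise : ∀ δ > 0, Tendsto (fun T : ℝ => μ {ω | ∃ x : ℝ,
      δ < ‖∫ t in (0:ℝ)..1, (G (ξ (T * t) ω) : ℂ) * Complex.exp (x * t * Complex.I)‖})
      atTop (𝓝 0) := fun δ hδ => tendsto_of_seq_tendsto fun _ hT =>
    tendsto_measure_periodogram hξmeas hB0 hB hgauss hGmeas hG1 hG0 hT hδ
  have hbad : ∀ ε > 0, Tendsto (fun T => μ {ω | ¬ ∀ k, |Aest T ω k - A k| < ε ∧
      |Best T ω k - B k| < ε ∧ |T * (φest T ω k - φ k)| < ε}) atTop (𝓝 0) := by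
    intro ε hε
    obtain ⟨δ, hδ, T₁, hT₁⟩ := exists_noise_threshold hN hAB hφmono hφpos hSsep hSfirst hε
    refine tendsto_of_tendsto_of_tendsto_of_le_of_le' tendsto_const_nhds (hnoise δ hδ)
      (Eventually.of_forall fun _ => zero_le) ?_
    filter_upwards [eventually_ge_atTop T₁, eventually_gt_atTop T₀] with T hTT₁ hTT₀
    have hTpos : 0 < T := hT₀.trans hTT₀
    refine measure_mono_ae ?_
    filter_upwards [ae_intervalIntegrable_comp_process hξmeas hlaw hGmeas hG1 T,
      ae_intervalIntegrable_comp_process hξmeas hlaw (hGmeas.pow_const 2) hG2 T] with ω i1 i2 hω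
    by_contra hcon
    refine hω (hT₁ T hTT₁ (Aest T ω) (Best T ω) (φest T ω) (fun t => G (ξ (T * t) ω))
      (hLSE T hTT₀ ω).1 i1 i2 (fun x => le_of_not_gt fun h => hcon ⟨x, h⟩) ?_)
    have h := (hLSE T hTT₀ ω).2 A B φ (subset_closure (hStrue T hTT₀))
    rw [inv_mul_integral_Ioc_eq_integral_comp_mul hTpos,
      inv_mul_integral_Ioc_eq_integral_comp_mul hTpos] at h
    simpa [hx, mul_assoc, mul_left_comm] using h
  intro k
  refine ⟨?_, ?_, ?_⟩ <;>
  · rw [tendstoInMeasure_iff_dist]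
    intro ε hε
    refine tendsto_of_tendsto_of_tendsto_of_le_of_le tendsto_const_nhds (hbad ε hε)
      (fun _ => zero_le) fun T => measure_mono fun ω hω hall => ?_
    have h1 := hall k
    simp only [Set.mem_ofPred_eq, Real.dist_eq, sub_zero] at hω
    linarith [h1.1, h1.2.1, h1.2.2]
end
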